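/- arXiv:math/0602378 — 10 statements merged into one kernel-verified Lean document; each statement's English description precedes it below -/
import Mathlib

section
/- Let n ≥ 1 and let M be a nonempty subset of Sym(n,ℝ). The following are equivalent: (i) the only positive semidefinite matrix in span_ℝ M is 0 (i.e. M is non-dissipative); (ii) there exists a symmetric positive definite matrix Q ∈ Sym(n,ℝ) such that tr(QᵀFQ) = 0 for every F ∈ M; (iii) there exists an invertible matrix T ∈ GL(n,ℝ) such that tr(TᵀFT) = 0 for every F ∈ M. -/
open Matrix

section Nondissipative

variable {n : Type*} [Fintype n]

theorem Matrix.isCompact_setOf_trace_transpose_mul_self_eq_one :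
    IsCompact {B : Matrix n n ℝ | (Bᵀ * B).trace = 1} := by
  have hbox : IsCompact (Set.pi Set.univ fun _ : n => Set.pi Set.univ fun _ : n =>
      Set.Icc (-1 : ℝ) 1) :=
    isCompact_univ_pi fun _ => isCompact_univ_pi fun _ => isCompact_Icc
  refine IsCompact.of_isClosed_subset (X := Matrix n n ℝ) hbox
    (isClosed_eq (by fun_prop) continuous_const) fun B hB i _ j _ => ?_
  have hsum : ∑ l, ∑ k, B k l * B k l = 1 := by
    simpa [Matrix.trace, Matrix.mul_apply] using hB
  have h1 : B i j * B i j ≤ ∑ k, B k j * B k j :=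
    Finset.single_le_sum (f := fun k => B k j * B k j)
      (fun k _ => mul_self_nonneg _) (Finset.mem_univ i)
  have h2 : ∑ k, B k j * B k j ≤ ∑ l, ∑ k, B k l * B k l :=
    Finset.single_le_sum (f := fun l => ∑ k, B k l * B k l)
      (fun l _ => Finset.sum_nonneg fun k _ => mul_self_nonneg _) (Finset.mem_univ j)
  exact ⟨by nlinarith, by nlinarith⟩

open scoped MatrixOrder in
theorem Matrix.isCompact_setOf_posSemidef_trace_eq_one :
    IsCompact {A : Matrix n n ℝ | A.PosSemidef ∧ A.trace = 1} := by
  have himage : {A : Matrix n n ℝ | A.PosSemidef ∧ A.trace = 1} =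
      (fun B : Matrix n n ℝ => Bᵀ * B) '' {B | (Bᵀ * B).trace = 1} := by
    classical
    ext A
    constructor
    · rintro ⟨hA, htr⟩
      obtain ⟨B, rfl⟩ := CStarAlgebra.nonneg_iff_eq_star_mul_self.mp hA.nonneg
      exact ⟨B, by simpa [star_eq_conjTranspose] using htr, by simp [star_eq_conjTranspose]⟩
    · rintro ⟨B, hB, rfl⟩
      exact ⟨by simpa using posSemidef_conjTranspose_mul_self B, hB⟩
  rw [himage]
  exact isCompact_setOf_trace_transpose_mul_self_eq_one.image (by fun_prop)

theorem Matrix.convex_setOf_posSemidef_trace_eq_one :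
    Convex ℝ {A : Matrix n n ℝ | A.PosSemidef ∧ A.trace = 1} := by
  rintro A ⟨hA, hAtr⟩ B ⟨hB, hBtr⟩ a b ha hb hab
  exact ⟨(hA.smul ha).add (hB.smul hb), by simp [hAtr, hBtr, hab]⟩

instance Matrix.locallyConvexSpace_real : LocallyConvexSpace ℝ (Matrix n n ℝ) :=
  inferInstanceAs (LocallyConvexSpace ℝ (n → n → ℝ))

/-- A subspace containing no nonzero positive semidefinite matrix is annihilated by a linear
functional that is positive on the nonzero positive semidefinite matrices. -/
theorem Submodule.exists_linearMap_pos_of_posSemidef (S : Submodule ℝ (Matrix n n ℝ))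
    (hS : ∀ F ∈ S, F.PosSemidef → F = 0) :
    ∃ g : Matrix n n ℝ →ₗ[ℝ] ℝ, (∀ F ∈ S, g F = 0) ∧
      ∀ A : Matrix n n ℝ, A.PosSemidef → A ≠ 0 → 0 < g A := by
  obtain ⟨f, u, v, hu, huv, hv⟩ := geometric_hahn_banach_compact_closed
    convex_setOf_posSemidef_trace_eq_one isCompact_setOf_posSemidef_trace_eq_one
    S.convex S.closed_of_finiteDimensional <| Set.disjoint_left.mpr fun A hA hAS => by
      have htr := hA.2
      simp [hS A hAS hA.1] at htr
  have hf0 : ∀ F ∈ S, f F = 0 := by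
    intro F hF
    by_contra hne
    have h := hv _ (S.smul_mem ((v - 1) / f F) hF)
    simp [div_mul_cancel₀ _ hne] at h
    linarith
  have hv0 : v < 0 := by simpa using hv 0 S.zero_mem
  refine ⟨-f.toLinearMap, fun F hF => by simp [hf0 F hF], fun A hA hne => ?_⟩
  have htr : 0 < A.trace :=
    hA.trace_nonneg.lt_of_ne fun h => hne (hA.trace_eq_zero_iff.mp h.symm)
  have h := hu (A.trace⁻¹ • A)
    ⟨hA.smul (inv_nonneg.mpr htr.le), by simp [inv_mul_cancel₀ htr.ne']⟩
  have h' : A.trace⁻¹ * f A < 0 := by simpa using h.trans (huv.trans hv0)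
  have : f A < 0 := by
    by_contra hn
    exact absurd h' (not_lt.mpr (mul_nonneg (inv_nonneg.mpr htr.le) (not_lt.mp hn)))
  simpa using this

variable [DecidableEq n]

theorem LinearMap.apply_eq_sum_single (g : Matrix n n ℝ →ₗ[ℝ] ℝ) (A : Matrix n n ℝ) :
    g A = ∑ i, ∑ j, A i j * g (Matrix.single i j 1) := by
  conv_lhs => rw [matrix_eq_sum_single A]
  simp only [map_sum]
  refine Finset.sum_congr rfl fun i _ => Finset.sum_congr rfl fun j _ => ?_
  rw [← smul_eq_mul, ← map_smul, Matrix.smul_single, smul_eq_mul, mul_one]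

/-- A linear functional that is positive on the nonzero positive semidefinite matrices is, on
symmetric matrices, the trace pairing with a positive definite matrix. -/
theorem LinearMap.exists_posDef_trace_mul_eq (g : Matrix n n ℝ →ₗ[ℝ] ℝ)
    (hg : ∀ A : Matrix n n ℝ, A.PosSemidef → A ≠ 0 → 0 < g A) :
    ∃ P : Matrix n n ℝ, P.PosDef ∧ ∀ F : Matrix n n ℝ, F.IsSymm → (F * P).trace = g F := by
  let P : Matrix n n ℝ := Matrix.of fun i j =>
    (g (Matrix.single i j 1) + g (Matrix.single j i 1)) / 2
  have hPtr : ∀ F : Matrix n n ℝ, F.IsSymm → (F * P).trace = g F := by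
    intro F hF
    have h1 := g.apply_eq_sum_single F
    have h2 : g F = ∑ i, ∑ j, F i j * g (Matrix.single j i 1) := by
      rw [h1, Finset.sum_comm]
      simp only [hF.apply]
    have h3 : (F * P).trace = (∑ i, ∑ j, F i j * g (Matrix.single i j 1) +
        ∑ i, ∑ j, F i j * g (Matrix.single j i 1)) / 2 := by
      simp only [Matrix.trace, Matrix.diag, Matrix.mul_apply, P, Matrix.of_apply,
        ← Finset.sum_add_distrib, Finset.sum_div]
      exact Finset.sum_congr rfl fun i _ => Finset.sum_congr rfl fun j _ => by ring
    rw [h3, ← h1, ← h2, add_self_div_two]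
  refine ⟨P, posDef_iff_dotProduct_mulVec.mpr ⟨?_, fun x hx => ?_⟩, hPtr⟩
  · ext i j
    simp [P, add_comm]
  · have hpsd : (vecMulVec x x).PosSemidef := by
      simpa using posSemidef_vecMulVec_self_star x
    have hne : vecMulVec x x ≠ 0 := by simpa [vecMulVec_eq_zero] using hx
    have hpos := hg _ hpsd hne
    rw [← hPtr _ (by simpa using hpsd.isHermitian), vecMulVec_mul, trace_vecMulVec] at hpos
    rwa [dotProduct_mulVec, dotProduct_comm, star_trivial]

open scoped MatrixOrder in
theorem Matrix.PosDef.exists_posDef_mul_self_eq {P : Matrix n n ℝ} (hP : P.PosDef) :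
    ∃ Q : Matrix n n ℝ, Q.PosDef ∧ Q * Q = P := by
  have hmul : CFC.sqrt P * CFC.sqrt P = P := CFC.sqrt_mul_sqrt_self P hP.posSemidef.nonneg
  refine ⟨CFC.sqrt P, (CFC.sqrt_nonneg P).posSemidef.posDef_iff_isUnit.mpr ?_, hmul⟩
  exact isUnit_of_mul_isUnit_left (hmul.symm ▸ hP.isUnit)

theorem Submodule.eq_zero_of_posSemidef_of_trace_conj_eq_zero {M : Set (Matrix n n ℝ)}
    {T : Matrix n n ℝ} (hT : IsUnit T) (hM : ∀ F ∈ M, (Tᵀ * F * T).trace = 0)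
    {F : Matrix n n ℝ} (hF : F ∈ Submodule.span ℝ M) (hpsd : F.PosSemidef) : F = 0 := by
  have htr : (Tᵀ * F * T).trace = 0 := by
    clear hpsd
    induction hF using Submodule.span_induction with
    | mem F hF => exact hM F hF
    | zero => simp
    | add F G _ _ hF hG => simp [Matrix.mul_add, Matrix.add_mul, hF, hG]
    | smul a F _ hF => simp [hF]
  have hpsd' : (Tᵀ * F * T).PosSemidef := by simpa using hpsd.conjTranspose_mul_mul_same T
  have hzero := hpsd'.trace_eq_zero_iff.mp htr
  rwa [hT.mul_left_eq_zero, (isUnit_transpose T |>.mpr hT).mul_right_eq_zero] at hzero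

end Nondissipative

/-- For a nonempty set `M` of real symmetric `n × n` matrices (`n ≥ 1`),
the following are equivalent:
(i) the only positive semidefinite matrix in `span ℝ M` is `0` (`M` is non-dissipative);
(ii) there is a positive definite `Q` with `tr (Qᵀ F Q) = 0` for all `F ∈ M`;
(iii) there is an invertible `T` with `tr (Tᵀ F T) = 0` for all `F ∈ M`. -/
theorem nondissipative_tfae (n : ℕ) (hn : 1 ≤ n)
    (M : Set (Matrix (Fin n) (Fin n) ℝ)) (hM : M.Nonempty)
    (hMsymm : ∀ F ∈ M, F.IsSymm) :
    ((∀ F ∈ Submodule.span ℝ M, F.PosSemidef → F = 0) ↔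
      ∃ Q : Matrix (Fin n) (Fin n) ℝ, Q.IsSymm ∧ Q.PosDef ∧
        ∀ F ∈ M, (Qᵀ * F * Q).trace = 0) ∧
    ((∀ F ∈ Submodule.span ℝ M, F.PosSemidef → F = 0) ↔
      ∃ T : Matrix (Fin n) (Fin n) ℝ, IsUnit T ∧
        ∀ F ∈ M, (Tᵀ * F * T).trace = 0) := by
  have hii_iii : (∃ Q : Matrix (Fin n) (Fin n) ℝ, Q.IsSymm ∧ Q.PosDef ∧
      ∀ F ∈ M, (Qᵀ * F * Q).trace = 0) →
      ∃ T : Matrix (Fin n) (Fin n) ℝ, IsUnit T ∧ ∀ F ∈ M, (Tᵀ * F * T).trace = 0 :=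
    fun ⟨Q, _, hQ, hQM⟩ => ⟨Q, hQ.isUnit, hQM⟩
  have hiii_i : (∃ T : Matrix (Fin n) (Fin n) ℝ, IsUnit T ∧
      ∀ F ∈ M, (Tᵀ * F * T).trace = 0) →
      ∀ F ∈ Submodule.span ℝ M, F.PosSemidef → F = 0 :=
    fun ⟨_, hT, hTM⟩ _ hF hpsd =>
      Submodule.eq_zero_of_posSemidef_of_trace_conj_eq_zero hT hTM hF hpsd
  have hi_ii : (∀ F ∈ Submodule.span ℝ M, F.PosSemidef → F = 0) →
      ∃ Q : Matrix (Fin n) (Fin n) ℝ, Q.IsSymm ∧ Q.PosDef ∧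
        ∀ F ∈ M, (Qᵀ * F * Q).trace = 0 := by
    intro h
    obtain ⟨g, hg0, hgpos⟩ := (Submodule.span ℝ M).exists_linearMap_pos_of_posSemidef h
    obtain ⟨P, hP, hPtr⟩ := g.exists_posDef_trace_mul_eq hgpos
    obtain ⟨Q, hQ, rfl⟩ := hP.exists_posDef_mul_self_eq
    have hQsymm : Q.IsSymm := by simpa using hQ.isHermitian
    refine ⟨Q, hQsymm, hQ, fun F hF => ?_⟩
    rw [hQsymm.eq, Matrix.mul_assoc, Matrix.trace_mul_comm, Matrix.mul_assoc,
      hPtr F (hMsymm F hF), hg0 F (Submodule.subset_span hF)]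
  exact ⟨⟨hi_ii, hiii_i ∘ hii_iii⟩, ⟨hii_iii ∘ hi_ii, hiii_i⟩⟩
end

section
/- Let A, B ∈ Sym(n,ℝ) with tr A = 0 and tr B = 0. If Γ_A ⊆ Γ_B, then there exists c ∈ ℝ such that B = cA. -/
open Matrix

namespace Matrix

variable {ι : Type*} [Fintype ι] [DecidableEq ι]

/-- The coordinate characters of the sign group `ι → ℤˣ` are orthogonal. -/
lemma sum_signs_mul (i j : ι) :
    ∑ e : ι → ℤˣ, (((e i : ℤ) : ℝ) * ((e j : ℤ) : ℝ)) =
      if i = j then (Fintype.card (ι → ℤˣ) : ℝ) else 0 := by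
  split_ifs with hij
  · subst hij
    simp [← Int.cast_mul, ← Units.val_mul]
  · have key := Equiv.sum_comp (Equiv.mulLeft (Pi.mulSingle i (-1) : ι → ℤˣ))
      (fun e : ι → ℤˣ => (((e i : ℤ) : ℝ) * ((e j : ℤ) : ℝ)))
    have hji : j ≠ i := Ne.symm hij
    simp only [Equiv.coe_mulLeft, Pi.mul_apply, Pi.mulSingle_eq_same,
      Pi.mulSingle_eq_of_ne hji, one_mul, neg_mul, Units.val_neg, Int.cast_neg,
      Finset.sum_neg_distrib] at key
    linarith

/-- Summing a quadratic form over all sign vectors gives a multiple of the trace. -/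
lemma sum_signs_quadratic (N : Matrix ι ι ℝ) :
    ∑ e : ι → ℤˣ, (fun i => ((e i : ℤ) : ℝ)) ⬝ᵥ N *ᵥ (fun i => ((e i : ℤ) : ℝ)) =
      Fintype.card (ι → ℤˣ) * N.trace := by
  have expand (e : ι → ℤˣ) :
      (fun i => ((e i : ℤ) : ℝ)) ⬝ᵥ N *ᵥ (fun i => ((e i : ℤ) : ℝ)) =
        ∑ i, ∑ j, N i j * (((e i : ℤ) : ℝ) * ((e j : ℤ) : ℝ)) := by
    simp only [dotProduct, mulVec, Finset.mul_sum]
    refine Finset.sum_congr rfl fun i _ => Finset.sum_congr rfl fun j _ => ?_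
    ring
  simp only [expand]
  rw [Finset.sum_comm]
  simp_rw [Finset.sum_comm (s := (Finset.univ : Finset (ι → ℤˣ))), ← Finset.mul_sum,
    sum_signs_mul]
  simp [trace, Finset.mul_sum, mul_comm]

/-- The value of a diagonal quadratic form at a sign vector is the trace. -/
lemma signs_quadratic_diagonal (d : ι → ℝ) (e : ι → ℤˣ) :
    (fun i => ((e i : ℤ) : ℝ)) ⬝ᵥ diagonal d *ᵥ (fun i => ((e i : ℤ) : ℝ)) = ∑ i, d i := by
  simp only [dotProduct, mulVec_diagonal]
  refine Finset.sum_congr rfl fun i _ => ?_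
  have h : ((e i : ℤ) : ℝ) * ((e i : ℤ) : ℝ) = 1 := by
    simp [← Int.cast_mul, ← Units.val_mul]
  linear_combination d i * h

lemma dotProduct_mulVec_mulVec {κ : Type*} [Fintype κ] (P N : Matrix κ κ ℝ) (x : κ → ℝ) :
    (P *ᵥ x) ⬝ᵥ N *ᵥ (P *ᵥ x) = x ⬝ᵥ (Pᵀ * N * P) *ᵥ x := by
  rw [← mulVec_mulVec, ← mulVec_mulVec, dotProduct_mulVec x, vecMul_transpose]

open scoped MatrixOrder Matrix.Norms.L2Operator in
/-- If `Q_A ≤ 0` implies `Q_B ≤ 0`, the implication extends from rank-one matrices to positive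
semidefinite matrices in the kernel of `M ↦ tr (A M)`. -/
lemma trace_mul_nonpos_of_posSemidef {A B M : Matrix ι ι ℝ} (hA : A.IsSymm)
    (h : ∀ x : ι → ℝ, x ⬝ᵥ A *ᵥ x ≤ 0 → x ⬝ᵥ B *ᵥ x ≤ 0)
    (hM : M.PosSemidef) (hAM : (A * M).trace = 0) : (B * M).trace ≤ 0 := by
  obtain ⟨R, rfl⟩ : ∃ R : Matrix ι ι ℝ, M = R * Rᵀ := by
    obtain ⟨S, hS⟩ := CStarAlgebra.nonneg_iff_eq_star_mul_self.mp hM.nonneg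
    exact ⟨Sᵀ, by simpa [star_eq_conjTranspose] using hS⟩
  have hN : (Rᵀ * A * R).IsHermitian := by
    simp [IsHermitian, conjTranspose_eq_transpose_of_trivial, hA.eq, mul_assoc]
  set U : Matrix ι ι ℝ := ↑hN.eigenvectorUnitary
  have hUU : U * Uᵀ = 1 := by
    simpa [star_eq_conjTranspose] using Unitary.coe_mul_star_self hN.eigenvectorUnitary
  have hUU' : Uᵀ * U = 1 := mul_eq_one_comm.mp hUU
  obtain ⟨d, hspec⟩ : ∃ d : ι → ℝ, Rᵀ * A * R = U * diagonal d * Uᵀ :=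
    ⟨hN.eigenvalues, by
      simpa [star_eq_conjTranspose, Unitary.conjStarAlgAut_apply] using hN.spectral_theorem⟩
  have hconj (C : Matrix ι ι ℝ) : (R * U)ᵀ * C * (R * U) = Uᵀ * (Rᵀ * C * R) * U := by
    simp [mul_assoc]
  have htr (C : Matrix ι ι ℝ) : ((R * U)ᵀ * C * (R * U)).trace = (C * (R * Rᵀ)).trace := by
    rw [hconj, trace_mul_cycle, hUU, one_mul, trace_mul_cycle, trace_mul_comm]
  have hdiag : (R * U)ᵀ * A * (R * U) = diagonal d := by
    rw [hconj, hspec, ← mul_assoc, ← mul_assoc, hUU', one_mul, mul_assoc, hUU', mul_one]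
  have hsum : ∑ i, d i = 0 := by
    rw [← trace_diagonal, ← hdiag, htr, hAM]
  have hle : ∑ e : ι → ℤˣ, (fun i => ((e i : ℤ) : ℝ)) ⬝ᵥ
      ((R * U)ᵀ * B * (R * U)) *ᵥ (fun i => ((e i : ℤ) : ℝ)) ≤ 0 := by
    refine Finset.sum_nonpos fun e _ => ?_
    rw [← dotProduct_mulVec_mulVec]
    apply h
    rw [dotProduct_mulVec_mulVec, hdiag, signs_quadratic_diagonal, hsum]
  rw [sum_signs_quadratic, htr] at hle
  exact nonpos_of_mul_nonpos_right hle (by exact_mod_cast Fintype.card_pos)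

/-- A symmetric matrix becomes positive semidefinite after adding a large scalar matrix. -/
lemma IsSymm.exists_posSemidef_smul_one_add {V : Matrix ι ι ℝ} (hV : V.IsSymm) :
    ∃ k : ℝ, (k • (1 : Matrix ι ι ℝ) + V).PosSemidef := by
  refine ⟨∑ i, ∑ j, |V i j|, PosSemidef.of_dotProduct_mulVec_nonneg ?_ fun x => ?_⟩
  · simp [IsHermitian, conjTranspose_eq_transpose_of_trivial, hV.eq]
  · have hcoord (i : ι) : x i ^ 2 ≤ x ⬝ᵥ x := by
      simp only [dotProduct, ← sq]
      exact Finset.single_le_sum (fun j _ => sq_nonneg (x j)) (Finset.mem_univ i)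
    have hterm (i j : ι) : 0 ≤ |V i j| * (x ⬝ᵥ x) + x i * (V i j * x j) := by
      have hx : |x i * x j| ≤ x ⬝ᵥ x := by
        rw [abs_le]
        constructor <;> nlinarith [hcoord i, hcoord j, sq_nonneg (x i + x j),
          sq_nonneg (x i - x j)]
      have h₁ := mul_le_mul_of_nonneg_left hx (abs_nonneg (V i j))
      rw [← abs_mul] at h₁
      have h₂ := neg_abs_le (V i j * (x i * x j))
      linarith
    have hsum := Finset.sum_nonneg fun i (_ : i ∈ Finset.univ) =>
      Finset.sum_nonneg fun j (_ : j ∈ Finset.univ) => hterm i j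
    simp only [Finset.sum_add_distrib, ← Finset.sum_mul, ← Finset.mul_sum] at hsum
    rw [star_trivial, add_mulVec, smul_mulVec, one_mulVec, dotProduct_add, dotProduct_smul,
      smul_eq_mul]
    simpa only [dotProduct, mulVec] using hsum

end Matrix

/-- Let `A, B` be real symmetric `n × n` matrices with `tr A = tr B = 0`.
If `Γ_A ⊆ Γ_B` (where `Γ_A = {x : xᵀAx ≤ 0}`), then `B = c • A` for some `c ∈ ℝ`. -/
theorem trace_zero_cone_subset {n : ℕ} (A B : Matrix (Fin n) (Fin n) ℝ)
    (hAs : A.IsSymm) (hBs : B.IsSymm)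
    (htrA : A.trace = 0) (htrB : B.trace = 0)
    (h : {x : Fin n → ℝ | x ⬝ᵥ A.mulVec x ≤ 0} ⊆ {x : Fin n → ℝ | x ⬝ᵥ B.mulVec x ≤ 0}) :
    ∃ c : ℝ, B = c • A := by
  obtain ⟨c, hc⟩ : ∃ c : ℝ, (A * (B - c • A)).trace = 0 := by
    by_cases hA : (A * A).trace = 0
    · have hA0 : A = 0 := by
        rw [← trace_conjTranspose_mul_self_eq_zero_iff, conjTranspose_eq_transpose_of_trivial,
          hAs.eq, hA]
      exact ⟨0, by simp [hA0]⟩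
    · refine ⟨(A * B).trace / (A * A).trace, ?_⟩
      simp [mul_sub, div_mul_cancel₀ _ hA]
  refine ⟨c, sub_eq_zero.mp ?_⟩
  have hV : (B - c • A).IsSymm := hBs.sub (hAs.smul c)
  obtain ⟨k, hk⟩ := hV.exists_posSemidef_smul_one_add
  have hB := trace_mul_nonpos_of_posSemidef hAs (fun x hx => h hx) hk
    (by simpa [mul_add, htrA] using hc)
  have hBV : (B * (B - c • A)).trace ≤ 0 := by simpa [mul_add, htrB] using hB
  have hle : ((B - c • A)ᴴ * (B - c • A)).trace ≤ 0 := by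
    rw [conjTranspose_eq_transpose_of_trivial, hV.eq, sub_mul, trace_sub, smul_mul, trace_smul,
      hc]
    simpa using hBV
  rw [← trace_conjTranspose_mul_self_eq_zero_iff]
  exact le_antisymm hle (posSemidef_conjTranspose_mul_self _).trace_nonneg
end

section
/- Let 𝒜, ℬ ∈ Sym(k,ℝ) with 𝒜 positive definite, let ξ ∈ ℝ^k, and define f(x) := xᵀ𝒜x − 1 and g(x) := xᵀℬx + ξ·x − 1 for x ∈ ℝ^k. If f(x) ≤ 0 implies g(x) ≤ 0 for every x ∈ ℝ^k, then tr 𝒜 ≥ tr ℬ; moreover, either (𝒜 = ℬ and ξ = 0, i.e. f = g) or tr 𝒜 > tr ℬ. -/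
open Matrix

/-- If the sublevel set of `xᵀAx ≤ 1` is contained in that of `xᵀBx + ξ·x ≤ 1`, then scaling `x` and
`-x` to the boundary bounds `xᵀBx + √(xᵀAx) |ξ·x|` by `xᵀAx`. -/
theorem quadratic_add_abs_linear_le_of_sublevel {n : Type*} [Fintype n]
    {A B : Matrix n n ℝ} (hA : A.PosDef) {ξ : n → ℝ}
    (h : ∀ x : n → ℝ, x ⬝ᵥ A *ᵥ x - 1 ≤ 0 → x ⬝ᵥ B *ᵥ x + ξ ⬝ᵥ x - 1 ≤ 0) (x : n → ℝ) :
    x ⬝ᵥ B *ᵥ x + √(x ⬝ᵥ A *ᵥ x) * |ξ ⬝ᵥ x| ≤ x ⬝ᵥ A *ᵥ x := by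
  rcases eq_or_ne x 0 with rfl | hx
  · simp
  have hq : 0 < x ⬝ᵥ A *ᵥ x := by simpa using hA.dotProduct_mulVec_pos hx
  set q := x ⬝ᵥ A *ᵥ x with hq_def
  have hr : 0 < √q := Real.sqrt_pos.mpr hq
  have hrq : √q ^ 2 = q := Real.sq_sqrt hq.le
  have key : ∀ s : ℝ, s ^ 2 * q = 1 → s ^ 2 * (x ⬝ᵥ B *ᵥ x) + s * (ξ ⬝ᵥ x) ≤ 1 := by
    intro s hs
    have hsx := h (s • x)
    simp only [mulVec_smul, dotProduct_smul, smul_dotProduct, smul_eq_mul, ← mul_assoc,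
      ← pow_two, ← hq_def] at hsx
    linarith [hsx (by linarith)]
  have hs : (√q)⁻¹ ^ 2 * q = 1 := by rw [inv_pow, hrq, inv_mul_cancel₀ hq.ne']
  have scale : ∀ a b : ℝ, (√q)⁻¹ ^ 2 * a + (√q)⁻¹ * b ≤ 1 → a + √q * b ≤ q := by
    intro a b hab
    calc a + √q * b = √q ^ 2 * ((√q)⁻¹ ^ 2 * a + (√q)⁻¹ * b) := by field_simp
      _ ≤ √q ^ 2 * 1 := mul_le_mul_of_nonneg_left hab (sq_nonneg _)
      _ = q := by rw [mul_one, hrq]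
  rcases abs_choice (ξ ⬝ᵥ x) with habs | habs <;> rw [habs] <;> apply scale
  · exact key _ hs
  · simpa using key (-(√q)⁻¹) (by rwa [neg_sq])

/-- **Lemma 2.3.** Let `𝒜, ℬ` be real symmetric `k × k` matrices with `𝒜`
positive definite, let `ξ ∈ ℝ^k`, and set `f(x) = xᵀ𝒜x − 1`, `g(x) = xᵀℬx + ξ·x − 1`.
If `f(x) ≤ 0 → g(x) ≤ 0` for all `x`, then `tr 𝒜 ≥ tr ℬ`; moreover either `f = g`
(i.e. `𝒜 = ℬ` and `ξ = 0`) or `tr 𝒜 > tr ℬ`. -/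
theorem trace_comparison_of_sublevel {k : ℕ}
    (𝒜 ℬ : Matrix (Fin k) (Fin k) ℝ) (h𝒜s : 𝒜.IsSymm) (hℬs : ℬ.IsSymm)
    (h𝒜 : 𝒜.PosDef) (ξ : Fin k → ℝ)
    (h : ∀ x : Fin k → ℝ, x ⬝ᵥ 𝒜.mulVec x - 1 ≤ 0 →
      x ⬝ᵥ ℬ.mulVec x + ξ ⬝ᵥ x - 1 ≤ 0) :
    ℬ.trace ≤ 𝒜.trace ∧ ((𝒜 = ℬ ∧ ξ = 0) ∨ ℬ.trace < 𝒜.trace) := by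
  have key := quadratic_add_abs_linear_le_of_sublevel h𝒜 h
  have hpsd : (𝒜 - ℬ).PosSemidef := by
    refine .of_dotProduct_mulVec_nonneg ?_ fun x => ?_
    · exact h𝒜.isHermitian.sub (conjTranspose_eq_transpose_of_trivial ℬ |>.trans hℬs)
    · have : 0 ≤ √(x ⬝ᵥ 𝒜 *ᵥ x) * |ξ ⬝ᵥ x| := by positivity
      simp only [star_trivial, sub_mulVec, dotProduct_sub]
      linarith [key x]
  have htr : ℬ.trace ≤ 𝒜.trace := by simpa [trace_sub] using hpsd.trace_nonneg
  refine ⟨htr, htr.eq_or_lt.imp_left fun heq => ?_⟩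
  have hAB : 𝒜 = ℬ := sub_eq_zero.mp (hpsd.trace_eq_zero_iff.mp (by rw [trace_sub, heq, sub_self]))
  subst hAB
  refine ⟨rfl, by_contra fun hξ => ?_⟩
  have hpos : 0 < ξ ⬝ᵥ 𝒜 *ᵥ ξ := by simpa using h𝒜.dotProduct_mulVec_pos hξ
  have hξξ : ξ ⬝ᵥ ξ ≠ 0 := fun h0 => hξ (dotProduct_self_eq_zero.mp h0)
  have : 0 < √(ξ ⬝ᵥ 𝒜 *ᵥ ξ) * |ξ ⬝ᵥ ξ| := mul_pos (Real.sqrt_pos.mpr hpos) (abs_pos.mpr hξξ)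
  linarith [key ξ]
end

section
/- Let n ≥ 2, let M, N ∈ Sym(n,ℝ) be positive definite, let a, b ∈ ℝⁿ, and define the quadratic polynomials P(x) := (x−a)ᵀM(x−a) − 1 and Q(x) := (x−b)ᵀN(x−b) − 1, with associated open ellipsoids E := {x ∈ ℝⁿ : P(x) < 0} and D := {x ∈ ℝⁿ : Q(x) < 0}. Assume that at every point x with P(x) = 0 and Q(x) = 0 the gradients ∇P(x) and ∇Q(x) are linearly dependent (i.e. the boundaries do not intersect transversally anywhere). Then, if E ∩ D ≠ ∅, either E ⊆ D or D ⊆ E. -/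
open Matrix

/-- A real quadratic with positive leading coefficient and negative constant term has a positive
root. -/
theorem exists_pos_root_of_quadratic {c₂ c₁ c₀ : ℝ} (h₂ : 0 < c₂) (h₀ : c₀ < 0) :
    ∃ s, 0 < s ∧ c₂ * s ^ 2 + c₁ * s + c₀ = 0 := by
  have hpos : 0 < -(4 * c₂ * c₀) := by nlinarith [mul_pos h₂ (neg_pos.2 h₀)]
  obtain ⟨q, hq⟩ : ∃ q, Real.sqrt (c₁ ^ 2 - 4 * c₂ * c₀) = q := ⟨_, rfl⟩
  have hsq : q ^ 2 = c₁ ^ 2 - 4 * c₂ * c₀ := by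
    rw [← hq]
    exact Real.sq_sqrt (by nlinarith [sq_nonneg c₁])
  have hlt : c₁ < q := by
    rw [← hq]
    apply Real.lt_sqrt_of_sq_lt
    linarith
  refine ⟨(q - c₁) / (2 * c₂), div_pos (by linarith) (by linarith), ?_⟩
  field_simp
  linear_combination hsq

/-- A real quartic with negative leading coefficient that is positive at `t₀` has a root to the
right of `t₀`. -/
theorem exists_root_gt_of_quartic {c₄ c₃ c₂ c₁ c₀ t₀ : ℝ} (h₄ : c₄ < 0)
    (h : 0 < c₄ * t₀ ^ 4 + c₃ * t₀ ^ 3 + c₂ * t₀ ^ 2 + c₁ * t₀ + c₀) :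
    ∃ s, t₀ < s ∧ c₄ * s ^ 4 + c₃ * s ^ 3 + c₂ * s ^ 2 + c₁ * s + c₀ = 0 := by
  set p : Polynomial ℝ := .C c₄ * .X ^ 4 + .C c₃ * .X ^ 3 + .C c₂ * .X ^ 2 + .C c₁ * .X + .C c₀
    with hp
  have heval (t : ℝ) : p.eval t = c₄ * t ^ 4 + c₃ * t ^ 3 + c₂ * t ^ 2 + c₁ * t + c₀ := by
    simp [hp]
  have hdeg : p.natDegree = 4 := by
    rw [hp]
    compute_degree!
    exact h₄.ne
  have hlead : p.leadingCoeff = c₄ := by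
    rw [Polynomial.leadingCoeff, hdeg, hp]
    simp
  have hlim := p.tendsto_atBot_of_leadingCoeff_nonpos
    (Polynomial.natDegree_pos_iff_degree_pos.1 (by omega)) (by rw [hlead]; exact h₄.le)
  obtain ⟨T, hT, hTt⟩ :=
    ((hlim.eventually (Filter.eventually_lt_atBot 0)).and (Filter.eventually_gt_atTop t₀)).exists
  rw [← heval] at h
  obtain ⟨s, hs, hs0⟩ := intermediate_value_Icc' hTt.le p.continuous.continuousOn
    (show (0 : ℝ) ∈ Set.Icc _ _ from ⟨hT.le, h.le⟩)
  refine ⟨s, lt_of_le_of_ne hs.1 ?_, by rw [← heval]; exact hs0⟩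
  rintro rfl
  exact h.ne' hs0

/-- A real quartic with negative leading coefficient all of whose real roots are multiple roots is
nowhere positive. -/
theorem quartic_nonpos_of_multiple_roots {c₄ c₃ c₂ c₁ c₀ : ℝ} (h₄ : c₄ < 0)
    (hroot : ∀ t, c₄ * t ^ 4 + c₃ * t ^ 3 + c₂ * t ^ 2 + c₁ * t + c₀ = 0 →
      4 * c₄ * t ^ 3 + 3 * c₃ * t ^ 2 + 2 * c₂ * t + c₁ = 0) (t : ℝ) :
    c₄ * t ^ 4 + c₃ * t ^ 3 + c₂ * t ^ 2 + c₁ * t + c₀ ≤ 0 := by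
  by_contra! h
  obtain ⟨s, hts, hs⟩ := exists_root_gt_of_quartic h₄ h
  obtain ⟨r', htr, hr'⟩ := exists_root_gt_of_quartic (c₄ := c₄) (c₃ := -c₃) (c₂ := c₂)
    (c₁ := -c₁) (c₀ := c₀) (t₀ := -t) h₄ (h.trans_eq (by ring))
  obtain ⟨r, rfl⟩ : ∃ r, r' = -r := ⟨-r', by ring⟩
  have hr : c₄ * r ^ 4 + c₃ * r ^ 3 + c₂ * r ^ 2 + c₁ * r + c₀ = 0 := by
    linear_combination hr'
  have hs' := hroot s hs
  have hr' := hroot r hr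
  have hrs : 0 < s - r := by linarith
  have key : (s - r) ^ 3 * (c₄ * t ^ 4 + c₃ * t ^ 3 + c₂ * t ^ 2 + c₁ * t + c₀) =
      (s - r) ^ 3 * (c₄ * ((t - r) * (t - s)) ^ 2) := by
    linear_combination (s - r + 2 * (t - r)) * (t - s) ^ 2 * hr
      + (s - r) * (t - r) * (t - s) ^ 2 * hr'
      + (s - r - 2 * (t - s)) * (t - r) ^ 2 * hs + (s - r) * (t - s) * (t - r) ^ 2 * hs'
  have := mul_left_cancel₀ (pow_pos hrs 3).ne' key
  nlinarith [mul_nonneg (neg_nonneg.2 h₄.le) (sq_nonneg ((t - r) * (t - s)))]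

section QuadraticForm

variable {ι : Type*} [Fintype ι]

theorem Matrix.IsSymm.dotProduct_mulVec_comm {M : Matrix ι ι ℝ} (hM : M.IsSymm) (x y : ι → ℝ) :
    x ⬝ᵥ M *ᵥ y = y ⬝ᵥ M *ᵥ x := by
  rw [dotProduct_mulVec, ← mulVec_transpose, hM.eq, dotProduct_comm]

theorem Matrix.PosDef.dotProduct_mulVec_self_pos {M : Matrix ι ι ℝ} (hM : M.PosDef) {x : ι → ℝ}
    (hx : x ≠ 0) : 0 < x ⬝ᵥ M *ᵥ x := by
  simpa using hM.dotProduct_mulVec_pos hx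

/-- Expansion of a quadratic form along an affine line. -/
theorem Matrix.IsSymm.dotProduct_mulVec_add_smul {M : Matrix ι ι ℝ} (hM : M.IsSymm)
    (x e a : ι → ℝ) (s : ℝ) :
    (x + s • e - a) ⬝ᵥ M *ᵥ (x + s • e - a) =
      (e ⬝ᵥ M *ᵥ e) * s ^ 2 + 2 * (e ⬝ᵥ M *ᵥ (x - a)) * s + (x - a) ⬝ᵥ M *ᵥ (x - a) := by
  rw [show x + s • e - a = (x - a) + s • e by abel]
  simp only [mulVec_add, mulVec_smul, dotProduct_add, add_dotProduct, smul_dotProduct,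
    dotProduct_smul, smul_eq_mul, hM.dotProduct_mulVec_comm (x - a) e]
  ring

/-- If the boundary of an ellipsoid lies in the closure of a second ellipsoid, then the first
ellipsoid is contained in the second one. -/
theorem ellipsoid_subset_of_boundary_nonpos [Nonempty ι] {M N : Matrix ι ι ℝ} (hMs : M.IsSymm)
    (hNs : N.IsSymm) (hM : M.PosDef) (hN : N.PosDef) {a b : ι → ℝ}
    (h : ∀ x, (x - a) ⬝ᵥ M *ᵥ (x - a) = 1 → (x - b) ⬝ᵥ N *ᵥ (x - b) ≤ 1)
    {x : ι → ℝ} (hx : (x - a) ⬝ᵥ M *ᵥ (x - a) < 1) : (x - b) ⬝ᵥ N *ᵥ (x - b) < 1 := by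
  have he : (1 : ι → ℝ) ≠ 0 := one_ne_zero
  have hMe := hM.dotProduct_mulVec_self_pos he
  have hNe := hN.dotProduct_mulVec_self_pos he
  obtain ⟨s, hs, hs0⟩ := exists_pos_root_of_quadratic (c₁ := 2 * (1 ⬝ᵥ M *ᵥ (x - a))) hMe
    (sub_neg.2 hx)
  obtain ⟨r, hr, hr0⟩ := exists_pos_root_of_quadratic (c₁ := -(2 * (1 ⬝ᵥ M *ᵥ (x - a)))) hMe
    (sub_neg.2 hx)
  have h₁ := h (x + s • 1) (by rw [hMs.dotProduct_mulVec_add_smul]; linarith)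
  have h₂ := h (x + (-r) • 1) (by rw [hMs.dotProduct_mulVec_add_smul]; linarith)
  rw [hNs.dotProduct_mulVec_add_smul] at h₁ h₂
  have h₃ := mul_pos hNe (mul_pos (mul_pos hr hs) (add_pos hr hs))
  by_contra! hge
  nlinarith [mul_le_mul_of_nonneg_left h₁ hr.le, mul_le_mul_of_nonneg_left h₂ hs.le,
    mul_le_mul_of_nonneg_left hge (add_pos hr hs).le]

/-- If an ellipsoid meets a second one but not its boundary, then it is contained in the second
one. -/
theorem ellipsoid_subset_of_boundary_nonneg {M N : Matrix ι ι ℝ} (hMs : M.IsSymm)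
    (hNs : N.IsSymm) (hM : M.PosDef) (hN : N.PosDef) {a b : ι → ℝ}
    (h : ∀ x, (x - a) ⬝ᵥ M *ᵥ (x - a) = 1 → 1 ≤ (x - b) ⬝ᵥ N *ᵥ (x - b))
    {z : ι → ℝ} (hzM : (z - a) ⬝ᵥ M *ᵥ (z - a) < 1) (hzN : (z - b) ⬝ᵥ N *ᵥ (z - b) < 1)
    {x : ι → ℝ} (hx : (x - b) ⬝ᵥ N *ᵥ (x - b) < 1) : (x - a) ⬝ᵥ M *ᵥ (x - a) < 1 := by
  by_contra! hge
  have he : x - z ≠ 0 := by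
    intro h0
    rw [sub_eq_zero.1 h0] at hge
    linarith
  have hMe := hM.dotProduct_mulVec_self_pos he
  have hNe := hN.dotProduct_mulVec_self_pos he
  obtain ⟨s, hs, hs0⟩ := exists_pos_root_of_quadratic (c₁ := 2 * ((x - z) ⬝ᵥ M *ᵥ (z - a))) hMe
    (sub_neg.2 hzM)
  have h₁ := h (z + s • (x - z)) (by rw [hMs.dotProduct_mulVec_add_smul]; linarith)
  have hxz : x = z + (1 : ℝ) • (x - z) := by simp
  have hM₁ := hMs.dotProduct_mulVec_add_smul z (x - z) a 1
  have hN₁ := hNs.dotProduct_mulVec_add_smul z (x - z) b 1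
  rw [← hxz] at hM₁ hN₁
  rw [hM₁] at hge
  rw [hN₁] at hx
  rw [hNs.dotProduct_mulVec_add_smul] at h₁
  have hs1 : s ≤ 1 := by
    by_contra! hlt
    nlinarith [mul_le_mul_of_nonneg_left hge hs.le, mul_pos (mul_pos hMe hs) (sub_pos.2 hlt),
      mul_pos (sub_pos.2 hlt) (sub_pos.2 hzM)]
  nlinarith [mul_lt_mul_of_pos_left hx hs, mul_le_mul_of_nonneg_left hzN.le (sub_nonneg.2 hs1),
    mul_nonneg (mul_nonneg hNe.le hs.le) (sub_nonneg.2 hs1)]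

/-- Two distinct points of an ellipsoid's boundary lie on a common elliptic section through the
center, on which they are `t = ∞` and some finite `t` of a rational parametrization. -/
theorem exists_rational_parametrization [Nontrivial ι] {M : Matrix ι ι ℝ} (hMs : M.IsSymm)
    {e y : ι → ℝ} (he : e ⬝ᵥ M *ᵥ e = 1) (hy : y ⬝ᵥ M *ᵥ y = 1) (hne : y ≠ e) :
    ∃ (w : ι → ℝ) (t : ℝ), w ≠ 0 ∧ w ⬝ᵥ M *ᵥ e = 0 ∧
      (t ^ 2 + w ⬝ᵥ M *ᵥ w) • y = (t ^ 2 - w ⬝ᵥ M *ᵥ w) • e + (2 * t) • w := by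
  obtain ⟨α, hα⟩ : ∃ α, y ⬝ᵥ M *ᵥ e = α := ⟨_, rfl⟩
  have hα' : e ⬝ᵥ M *ᵥ y = α := by rw [hMs.dotProduct_mulVec_comm, hα]
  by_cases hw : y - α • e = 0
  · have hyα : y = α • e := sub_eq_zero.1 hw
    obtain ⟨w, hw0, hwe⟩ := exists_ne_zero_dotProduct_eq_zero (M *ᵥ e)
    have hsq : (α - 1) * (α + 1) = 0 := by
      rw [hyα] at hy
      simp only [mulVec_smul, smul_dotProduct, dotProduct_smul, smul_eq_mul, he] at hy
      linarith
    have hα1 : α = -1 := by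
      rcases mul_eq_zero.1 hsq with h | h
      · exact absurd (by rw [hyα, sub_eq_zero.1 h, one_smul]) hne
      · linarith
    refine ⟨w, 0, hw0, hwe, ?_⟩
    rw [hyα, hα1]
    simp
  · have hk : (y - α • e) ⬝ᵥ M *ᵥ (y - α • e) = 1 - α ^ 2 := by
      simp only [mulVec_sub, mulVec_smul, dotProduct_sub, sub_dotProduct, smul_dotProduct,
        dotProduct_smul, smul_eq_mul, he, hy, hα, hα']
      ring
    refine ⟨y - α • e, 1 + α, hw, ?_, ?_⟩
    · simp [sub_dotProduct, smul_dotProduct, hα, he]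
    · rw [hk]
      module

/-- If two ellipsoid boundaries meet nowhere transversally, then the first one cannot contain both
points inside and points outside of the second ellipsoid. -/
theorem boundary_nonpos_of_exists_neg [Nontrivial ι] {M N : Matrix ι ι ℝ} (hMs : M.IsSymm)
    (hNs : N.IsSymm) (hM : M.PosDef) {a b : ι → ℝ}
    (htan : ∀ x, (x - a) ⬝ᵥ M *ᵥ (x - a) = 1 → (x - b) ⬝ᵥ N *ᵥ (x - b) = 1 →
      ∀ τ, τ ⬝ᵥ M *ᵥ (x - a) = 0 → τ ⬝ᵥ N *ᵥ (x - b) = 0)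
    {u v : ι → ℝ} (hu : (u - a) ⬝ᵥ M *ᵥ (u - a) = 1) (hv : (v - a) ⬝ᵥ M *ᵥ (v - a) = 1)
    (huN : (u - b) ⬝ᵥ N *ᵥ (u - b) < 1) : (v - b) ⬝ᵥ N *ᵥ (v - b) ≤ 1 := by
  by_cases huv : v - a = u - a
  · rw [sub_left_inj.1 huv]
    exact huN.le
  obtain ⟨w, t₀, hw, hwe, ht₀⟩ := exists_rational_parametrization hMs hu hv huv
  have hk := hM.dotProduct_mulVec_self_pos hw
  obtain ⟨k, hkdef⟩ : ∃ k, w ⬝ᵥ M *ᵥ w = k := ⟨_, rfl⟩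
  obtain ⟨e, hedef⟩ : ∃ e, u - a = e := ⟨_, rfl⟩
  obtain ⟨d, hddef⟩ : ∃ d, a - b = d := ⟨_, rfl⟩
  have hub : u - b = e + d := by rw [← hedef, ← hddef]; abel
  have hew : e ⬝ᵥ M *ᵥ w = 0 := by rw [hMs.dotProduct_mulVec_comm, ← hedef, hwe]
  rw [hedef] at hu hwe ht₀
  rw [hkdef] at hk ht₀
  obtain ⟨A, hA⟩ : ∃ A, e ⬝ᵥ N *ᵥ e = A := ⟨_, rfl⟩
  obtain ⟨B, hB⟩ : ∃ B, e ⬝ᵥ N *ᵥ w = B := ⟨_, rfl⟩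
  obtain ⟨C, hC⟩ : ∃ C, w ⬝ᵥ N *ᵥ w = C := ⟨_, rfl⟩
  obtain ⟨F, hF⟩ : ∃ F, e ⬝ᵥ N *ᵥ d = F := ⟨_, rfl⟩
  obtain ⟨G, hG⟩ : ∃ G, w ⬝ᵥ N *ᵥ d = G := ⟨_, rfl⟩
  obtain ⟨H, hH⟩ : ∃ H, d ⬝ᵥ N *ᵥ d = H := ⟨_, rfl⟩
  have hB' : w ⬝ᵥ N *ᵥ e = B := by rw [hNs.dotProduct_mulVec_comm, hB]
  have hF' : d ⬝ᵥ N *ᵥ e = F := by rw [hNs.dotProduct_mulVec_comm, hF]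
  have hG' : d ⬝ᵥ N *ᵥ w = G := by rw [hNs.dotProduct_mulVec_comm, hG]
  have hpos (t : ℝ) : 0 < t ^ 2 + k := by positivity
  -- The value of the second quadratic on the parametrized curve, with denominators cleared.
  have hval (t : ℝ) (x : ι → ℝ)
      (hx : (t ^ 2 + k) • (x - a) = (t ^ 2 - k) • e + (2 * t) • w) :
      (t ^ 2 + k) ^ 2 * ((x - b) ⬝ᵥ N *ᵥ (x - b) - 1) =
        (A + 2 * F + (H - 1)) * t ^ 4 + (4 * B + 4 * G) * t ^ 3
          + (-2 * k * A + 4 * C + 2 * k * (H - 1)) * t ^ 2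
          + (-4 * k * B + 4 * k * G) * t + k ^ 2 * (A - 2 * F + (H - 1)) := by
    have hxb : (t ^ 2 + k) • (x - b) = (t ^ 2 - k) • e + (2 * t) • w + (t ^ 2 + k) • d := by
      rw [← hx, ← hddef]
      module
    have hsq : (t ^ 2 + k) ^ 2 * ((x - b) ⬝ᵥ N *ᵥ (x - b)) =
        ((t ^ 2 + k) • (x - b)) ⬝ᵥ N *ᵥ ((t ^ 2 + k) • (x - b)) := by
      simp only [mulVec_smul, smul_dotProduct, dotProduct_smul, smul_eq_mul]
      ring
    rw [mul_sub, hsq, hxb]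
    simp only [mulVec_add, mulVec_smul, dotProduct_add, add_dotProduct, smul_dotProduct,
      dotProduct_smul, smul_eq_mul, hA, hB, hC, hF, hG, hH, hB', hF', hG']
    ring
  have hneg : A + 2 * F + (H - 1) < 0 := by
    rw [hub] at huN
    simp only [mulVec_add, dotProduct_add, add_dotProduct, hA, hF, hH, hF'] at huN
    linarith
  have hfinal := quartic_nonpos_of_multiple_roots hneg (c₃ := 4 * B + 4 * G)
    (c₂ := -2 * k * A + 4 * C + 2 * k * (H - 1)) (c₁ := -4 * k * B + 4 * k * G)
    (c₀ := k ^ 2 * (A - 2 * F + (H - 1))) ?_ t₀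
  · rw [← hval t₀ v ht₀] at hfinal
    have := nonpos_of_mul_nonpos_right hfinal (pow_pos (hpos t₀) 2)
    linarith
  intro t ht
  obtain ⟨x, hxdef⟩ : ∃ x, x = a + (t ^ 2 + k)⁻¹ • ((t ^ 2 - k) • e + (2 * t) • w) := ⟨_, rfl⟩
  have hx : (t ^ 2 + k) • (x - a) = (t ^ 2 - k) • e + (2 * t) • w := by
    rw [hxdef, add_sub_cancel_left, smul_inv_smul₀ (hpos t).ne']
  have hxM : (x - a) ⬝ᵥ M *ᵥ (x - a) = 1 := by
    have hsq : (t ^ 2 + k) ^ 2 * ((x - a) ⬝ᵥ M *ᵥ (x - a)) =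
        ((t ^ 2 + k) • (x - a)) ⬝ᵥ M *ᵥ ((t ^ 2 + k) • (x - a)) := by
      simp only [mulVec_smul, smul_dotProduct, dotProduct_smul, smul_eq_mul]
      ring
    refine mul_left_cancel₀ (pow_pos (hpos t) 2).ne' (hsq.trans ?_)
    rw [hx]
    simp only [mulVec_add, mulVec_smul, dotProduct_add, add_dotProduct, smul_dotProduct,
      dotProduct_smul, smul_eq_mul, hu, hwe, hew, hkdef]
    ring
  have hxN : (x - b) ⬝ᵥ N *ᵥ (x - b) = 1 := by
    have := hval t x hx
    rw [ht] at this
    exact sub_eq_zero.1 ((mul_eq_zero.1 this).resolve_left (pow_pos (hpos t) 2).ne')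
  have hτ := htan x hxM hxN ((2 * t * k) • e + (k - t ^ 2) • w) <| by
    refine mul_left_cancel₀ (hpos t).ne' ?_
    rw [← smul_eq_mul, ← dotProduct_smul, ← mulVec_smul, hx]
    simp only [mulVec_add, mulVec_smul, dotProduct_add, add_dotProduct, smul_dotProduct,
      dotProduct_smul, smul_eq_mul, hu, hwe, hew, hkdef]
    ring
  have hτ' : ((2 * t * k) • e + (k - t ^ 2) • w) ⬝ᵥ
      N *ᵥ ((t ^ 2 - k) • e + (2 * t) • w + (t ^ 2 + k) • d) = 0 := by
    rw [← hx, ← hddef, ← smul_add, sub_add_sub_cancel, mulVec_smul, dotProduct_smul, hτ, smul_zero]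
  simp only [mulVec_add, mulVec_smul, dotProduct_add, add_dotProduct, smul_dotProduct,
    dotProduct_smul, smul_eq_mul, hA, hB, hC, hF, hG, hB'] at hτ'
  refine (mul_eq_zero.1 (?_ : (t ^ 2 + k) * _ = 0)).resolve_left (hpos t).ne'
  linear_combination 4 * t * ht + 4 * hτ'

end QuadraticForm

/-- **Proposition 2.4.** Let `E, D` be open ellipsoids in `ℝⁿ`, `n ≥ 2`, given by
`P(x) = (x−a)ᵀM(x−a) − 1 < 0` and `Q(x) = (x−b)ᵀN(x−b) − 1 < 0` with `M, N` positive definite.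
If at every common boundary point `x` (i.e. `P x = 0 = Q x`) the gradients `2M(x−a)` and
`2N(x−b)` are linearly dependent (no transversal intersection), and `E ∩ D ≠ ∅`, then
`E ⊆ D` or `D ⊆ E`. -/
theorem ellipsoids_nested_of_no_transversal {n : ℕ} (hn : 2 ≤ n)
    (M N : Matrix (Fin n) (Fin n) ℝ) (hMs : M.IsSymm) (hNs : N.IsSymm)
    (hM : M.PosDef) (hN : N.PosDef) (a b : Fin n → ℝ)
    (P Q : (Fin n → ℝ) → ℝ)
    (hP : ∀ x, P x = (x - a) ⬝ᵥ M.mulVec (x - a) - 1)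
    (hQ : ∀ x, Q x = (x - b) ⬝ᵥ N.mulVec (x - b) - 1)
    (E D : Set (Fin n → ℝ))
    (hE : E = {x | P x < 0}) (hD : D = {x | Q x < 0})
    (htrans : ∀ x, P x = 0 → Q x = 0 →
      ¬ LinearIndependent ℝ ![(2 : ℝ) • M.mulVec (x - a), (2 : ℝ) • N.mulVec (x - b)])
    (hED : (E ∩ D).Nonempty) :
    E ⊆ D ∨ D ⊆ E := by
  have : Nontrivial (Fin n) := Fin.nontrivial_iff_two_le.2 hn
  have htan (x : Fin n → ℝ) (hx : (x - a) ⬝ᵥ M *ᵥ (x - a) = 1)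
      (hx' : (x - b) ⬝ᵥ N *ᵥ (x - b) = 1) (τ : Fin n → ℝ) (hτ : τ ⬝ᵥ M *ᵥ (x - a) = 0) :
      τ ⬝ᵥ N *ᵥ (x - b) = 0 := by
    have hdep := htrans x (by rw [hP, hx, sub_self]) (by rw [hQ, hx', sub_self])
    contrapose! hdep
    refine LinearIndependent.pair_iff.2 fun s t hst => ?_
    have ht : t = 0 := by
      have := congrArg (τ ⬝ᵥ ·) hst
      simpa [hτ, hdep] using this
    subst ht
    have := congrArg ((x - a) ⬝ᵥ ·) hst
    simpa [hx] using this
  subst hE hD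
  obtain ⟨z, hzE, hzD⟩ := hED
  simp only [Set.mem_ofPred_eq, hP, hQ, sub_neg] at hzE hzD
  by_cases h : ∃ u, (u - a) ⬝ᵥ M *ᵥ (u - a) = 1 ∧ (u - b) ⬝ᵥ N *ᵥ (u - b) < 1
  · obtain ⟨u, hu, huN⟩ := h
    left
    intro x hx
    simp only [Set.mem_ofPred_eq, hP, hQ, sub_neg] at hx ⊢
    exact ellipsoid_subset_of_boundary_nonpos hMs hNs hM hN
      (fun v hv => boundary_nonpos_of_exists_neg hMs hNs hM htan hu hv huN) hx
  · push Not at h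
    right
    intro x hx
    simp only [Set.mem_ofPred_eq, hP, hQ, sub_neg] at hx ⊢
    exact ellipsoid_subset_of_boundary_nonneg hMs hNs hM hN h hzE hzD hx
end

section
/- Let A, B ∈ Sym(n,ℝ) be positive semidefinite with rank A ≥ 2 and rank B ≥ 2, and let D := {x ∈ ℝⁿ : Q_A(x) < 1} and E := {x ∈ ℝⁿ : Q_B(x) < 1}. Assume that at every point x with Q_A(x) = 1 and Q_B(x) = 1 the vectors Ax and Bx are linearly dependent (i.e. the boundaries of D and E do not intersect transversally anywhere). Then either E ⊆ D or D ⊆ E. -/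
open Matrix

/-- If `A` and `B` have dependent values at each common point of their unit level sets, then
they agree at every point where their quadratic forms agree. -/
theorem mulVec_eq_of_quadratic_eq {n : ℕ} {A B : Matrix (Fin n) (Fin n) ℝ}
    (hA : A.PosSemidef) (hB : B.PosSemidef)
    (htrans : ∀ x : Fin n → ℝ, x ⬝ᵥ A.mulVec x = 1 → x ⬝ᵥ B.mulVec x = 1 →
      ¬ LinearIndependent ℝ ![A.mulVec x, B.mulVec x])
    {x : Fin n → ℝ} (hx : x ⬝ᵥ A.mulVec x = x ⬝ᵥ B.mulVec x) :
    A.mulVec x = B.mulVec x := by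
  have hnonneg : 0 ≤ x ⬝ᵥ A.mulVec x := by simpa using hA.dotProduct_mulVec_nonneg x
  rcases hnonneg.eq_or_lt with h0 | hpos
  · have hAx : A.mulVec x = 0 := (hA.dotProduct_mulVec_zero_iff x).1 (by simpa using h0.symm)
    have hBx : B.mulVec x = 0 :=
      (hB.dotProduct_mulVec_zero_iff x).1 (by simpa using hx.symm.trans h0.symm)
    rw [hAx, hBx]
  · obtain ⟨c, hc0, hc⟩ : ∃ c : ℝ, c ≠ 0 ∧ c * (c * (x ⬝ᵥ A.mulVec x)) = 1 := by
      refine ⟨(√(x ⬝ᵥ A.mulVec x))⁻¹, by positivity, ?_⟩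
      have hne : √(x ⬝ᵥ A.mulVec x) ≠ 0 := by positivity
      field_simp
      exact (Real.sq_sqrt hpos.le).symm
    have hyA : (c • x) ⬝ᵥ A.mulVec (c • x) = 1 := by
      simpa [mulVec_smul] using hc
    have hyB : (c • x) ⬝ᵥ B.mulVec (c • x) = 1 := by
      simpa [mulVec_smul, ← hx] using hc
    have hdep := htrans _ hyA hyB
    rw [LinearIndependent.pair_iff] at hdep
    push Not at hdep
    obtain ⟨a, b, hab, hne⟩ := hdep
    have hsum : a + b = 0 := by
      simpa only [dotProduct_add, dotProduct_smul, hyA, hyB, smul_eq_mul, mul_one,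
        dotProduct_zero] using congrArg ((c • x) ⬝ᵥ ·) hab
    obtain rfl : b = -a := by linarith
    have ha : a ≠ 0 := fun h => hne h (by simp [h])
    rw [mulVec_smul, mulVec_smul, neg_smul, add_neg_eq_zero] at hab
    exact smul_right_injective _ hc0 (smul_right_injective _ ha hab)

/-- An indefinite symmetric form has an isotropic vector outside its kernel. -/
theorem exists_isotropic_mulVec_ne_zero {n : ℕ} {C : Matrix (Fin n) (Fin n) ℝ}
    (hC : C.IsSymm) {u v : Fin n → ℝ} (hu : 0 < u ⬝ᵥ C.mulVec u) (hv : v ⬝ᵥ C.mulVec v < 0) :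
    ∃ x : Fin n → ℝ, x ⬝ᵥ C.mulVec x = 0 ∧ C.mulVec x ≠ 0 := by
  have hsymm : v ⬝ᵥ C.mulVec u = u ⬝ᵥ C.mulVec v := by
    rw [dotProduct_mulVec, ← mulVec_transpose, hC.eq, dotProduct_comm]
  obtain ⟨t, -, ht⟩ : (0 : ℝ) ∈ (fun t : ℝ => ((1 - t) • u + t • v) ⬝ᵥ
      C.mulVec ((1 - t) • u + t • v)) '' Set.Icc 0 1 := by
    apply intermediate_value_Icc' zero_le_one
    · fun_prop
    · simpa using ⟨hv.le, hu.le⟩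
  refine ⟨_, ht, fun hzero => ?_⟩
  have h1 := congrArg (u ⬝ᵥ ·) hzero
  have h2 := congrArg (v ⬝ᵥ ·) hzero
  simp only [mulVec_add, mulVec_smul, dotProduct_add, dotProduct_smul, smul_eq_mul,
    dotProduct_zero, hsymm] at h1 h2
  have h3 : (1 - t) ^ 2 * (u ⬝ᵥ C.mulVec u) = t ^ 2 * (v ⬝ᵥ C.mulVec v) := by
    linear_combination (1 - t) * h1 - t * h2
  have h4 : (1 - t) ^ 2 * (u ⬝ᵥ C.mulVec u) = 0 :=
    le_antisymm (h3 ▸ mul_nonpos_of_nonneg_of_nonpos (sq_nonneg t) hv.le) (by positivity)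
  have h5 : t = 1 := by
    have := pow_eq_zero_iff two_ne_zero |>.1 ((mul_eq_zero.1 h4).resolve_right hu.ne')
    linarith
  subst h5
  linarith

/-- **Proposition 2.5.** Let `A, B` be positive semidefinite real symmetric
`n × n` matrices of rank `≥ 2`, and let `D = {Q_A < 1}`, `E = {Q_B < 1}`. If at every point
`x` with `Q_A x = 1 = Q_B x` the normal vectors `Ax` and `Bx` are linearly dependent
(the boundaries do not intersect transversally anywhere), then `E ⊆ D` or `D ⊆ E`. -/
theorem psd_sublevel_nested_of_no_transversal {n : ℕ}
    (A B : Matrix (Fin n) (Fin n) ℝ) (hAs : A.IsSymm) (hBs : B.IsSymm)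
    (hA : A.PosSemidef) (hB : B.PosSemidef)
    (hrA : 2 ≤ A.rank) (hrB : 2 ≤ B.rank)
    (htrans : ∀ x : Fin n → ℝ, x ⬝ᵥ A.mulVec x = 1 → x ⬝ᵥ B.mulVec x = 1 →
      ¬ LinearIndependent ℝ ![A.mulVec x, B.mulVec x]) :
    {x : Fin n → ℝ | x ⬝ᵥ B.mulVec x < 1} ⊆ {x : Fin n → ℝ | x ⬝ᵥ A.mulVec x < 1} ∨
    {x : Fin n → ℝ | x ⬝ᵥ A.mulVec x < 1} ⊆ {x : Fin n → ℝ | x ⬝ᵥ B.mulVec x < 1} := by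
  by_contra! h
  obtain ⟨h1, h2⟩ := h
  obtain ⟨p, hpB, hpA⟩ := Set.not_subset.1 h1
  obtain ⟨q, hqA, hqB⟩ := Set.not_subset.1 h2
  simp only [Set.mem_ofPred_eq, not_lt] at hpB hpA hqA hqB
  obtain ⟨x, hx, hne⟩ := exists_isotropic_mulVec_ne_zero (C := A - B) (hAs.sub hBs)
    (u := p) (v := q) (by rw [sub_mulVec, dotProduct_sub]; linarith)
    (by rw [sub_mulVec, dotProduct_sub]; linarith)
  rw [sub_mulVec, dotProduct_sub, sub_eq_zero] at hx
  exact hne (by rw [sub_mulVec, mulVec_eq_of_quadratic_eq hA hB htrans hx, sub_self])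
end

section
/- Let W ⊆ Sym(n,ℝ) be a nontrivial linear subspace, let r ≥ 0, and let A ∈ W have maximal rank among the elements of W, with at least 2 positive eigenvalues (counted with multiplicity). Assume there exists a point z ∈ ∂Γ_A^r with Az ≠ 0. Then there exists δ > 0 such that for every B ∈ W with ‖B − A‖ < δ the following holds: if there exists a point z' ∈ ∂Γ_B^r with Bz' ≠ 0, and if at every point z ∈ ∂Γ_A^r ∩ ∂Γ_B^r the vectors Az and Bz are linearly dependent (no transversal intersection of the boundaries), then Γ_A^r ⊆ Γ_B^r or Γ_B^r ⊆ Γ_A^r. -/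
open Matrix

lemma exists_pos_root_quartic {a e : ℝ} (ha : 0 < a) (he : e < 0) (b c d : ℝ) :
    ∃ t > 0, a + b * t + c * t ^ 2 + d * t ^ 3 + e * t ^ 4 = 0 := by
  set f : ℝ → ℝ := fun t => a + b * t + c * t ^ 2 + d * t ^ 3 + e * t ^ 4 with hf
  have hcont : Continuous f := by fun_prop
  set S : ℝ := |a| + |b| + |c| + |d| with hS
  have hSnn : 0 ≤ S := by positivity
  set T : ℝ := 1 + S / (-e) with hT
  have hT1 : 1 ≤ T := by
    have : 0 ≤ S / (-e) := div_nonneg hSnn (by linarith)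
    linarith
  have hTe : -e * T = -e + S := by
    rw [hT, mul_add, mul_one, mul_div_cancel₀ _ (by linarith : -e ≠ 0)]
  have hbound : f T ≤ 0 := by
    have h1 : a ≤ |a| * T ^ 3 :=
      (le_abs_self a).trans (le_mul_of_one_le_right (abs_nonneg a) (one_le_pow₀ hT1))
    have h2 : b * T ≤ |b| * T ^ 3 :=
      mul_le_mul (le_abs_self b) (le_self_pow₀ hT1 (by norm_num)) (by linarith) (abs_nonneg b)
    have h3 : c * T ^ 2 ≤ |c| * T ^ 3 :=
      mul_le_mul (le_abs_self c) (pow_le_pow_right₀ hT1 (by norm_num)) (by positivity)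
        (abs_nonneg c)
    have h4 : d * T ^ 3 ≤ |d| * T ^ 3 :=
      mul_le_mul_of_nonneg_right (le_abs_self d) (by positivity)
    have h5 : e * T ^ 4 = (e - S) * T ^ 3 := by linear_combination (-T ^ 3) * hTe
    have h6 : e * T ^ 3 ≤ 0 := mul_nonpos_of_nonpos_of_nonneg he.le (by positivity)
    simp only [hf]
    rw [h5, hS]
    linarith
  have h0 : 0 ≤ f 0 := by simp [hf, ha.le]
  obtain ⟨t, ht, hft⟩ :=
    intermediate_value_Icc' (by linarith : (0 : ℝ) ≤ T) hcont.continuousOn ⟨hbound, h0⟩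
  refine ⟨t, lt_of_le_of_ne ht.1 ?_, hft⟩
  rintro rfl
  simp [hf] at hft
  linarith

/-- A quartic with positive constant and negative leading coefficient has a simple real root. -/
lemma exists_simple_root_quartic {a e : ℝ} (ha : 0 < a) (he : e < 0) (b c d : ℝ) :
    ∃ t ≠ 0, a + b * t + c * t ^ 2 + d * t ^ 3 + e * t ^ 4 = 0 ∧
      b + 2 * c * t + 3 * d * t ^ 2 + 4 * e * t ^ 3 ≠ 0 := by
  obtain ⟨t, ht, hft⟩ := exists_pos_root_quartic ha he b c d
  obtain ⟨u, hu, hfu⟩ := exists_pos_root_quartic ha he (-b) c (-d)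
  by_contra! h
  have h1 := h t ht.ne' hft
  have h2 := h (-u) (by linarith) (by linear_combination hfu)
  have hne : (t + u) ^ 3 ≠ 0 := by positivity
  have key : (t + u) ^ 3 * (a - e * t ^ 2 * u ^ 2) = 0 := by
    linear_combination (3 * t + u) * u ^ 2 * hft - t * u ^ 2 * (t + u) * h1
      - (3 * (-u) - t) * t ^ 2 * hfu + u * t ^ 2 * (t + u) * h2
  have := (mul_eq_zero.mp key).resolve_left hne
  have : 0 < -e * (t ^ 2 * u ^ 2) := mul_pos (by linarith) (by positivity)
  linarith

lemma exists_pos_quadratic {d : ℝ} (hd : 0 < d) (a b : ℝ) :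
    ∃ s : ℝ, 0 < a + 2 * s * b + s ^ 2 * d := by
  refine ⟨(|a| + 2 * |b|) / d + 1, ?_⟩
  set s : ℝ := (|a| + 2 * |b|) / d + 1 with hs
  have h1 : 1 ≤ s := by
    have : 0 ≤ (|a| + 2 * |b|) / d := by positivity
    linarith
  have h2 : s * d = |a| + 2 * |b| + d := by rw [hs]; field_simp
  have h3 : |a| + d ≤ 2 * b + s * d := by linarith [neg_abs_le b]
  have h4 : |a| + d ≤ s * (2 * b + s * d) :=
    h3.trans (le_mul_of_one_le_left (by linarith [abs_nonneg a]) h1)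
  nlinarith [neg_abs_le a]

section BilinForm

variable {E : Type*} [AddCommGroup E] [Module ℝ E]

/-- If a symmetric form has opposite signs at `x` and `y`, the line `x + t y` contains an isotropic
vector outside the radical of the form on `span {x, y}`, with `t` of any prescribed sign. -/
lemma exists_isotropic_add_smul {P : LinearMap.BilinForm ℝ E} (hP : ∀ u v, P u v = P v u)
    {x y : E} (hx : 0 < P x x) (hy : P y y < 0) (c : ℝ) :
    ∃ t ≠ 0, 0 ≤ t * c ∧ P (x + t • y) (x + t • y) = 0 ∧ P (x + t • y) x ≠ 0 := by
  obtain ⟨t, ht0, htc, ht⟩ : ∃ t ≠ 0, 0 ≤ t * c ∧ P x x + 2 * t * P x y + t ^ 2 * P y y = 0 := by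
    rcases le_total 0 c with hc | hc
    · obtain ⟨s, hs, h⟩ := exists_pos_root_quartic hx hy 0 (2 * P x y) 0
      exact ⟨s ^ 2, by positivity, by positivity, by linear_combination h⟩
    · obtain ⟨s, hs, h⟩ := exists_pos_root_quartic hx hy 0 (-2 * P x y) 0
      exact ⟨-s ^ 2, by simp [hs.ne'], by nlinarith [sq_nonneg s], by linear_combination h⟩
  refine ⟨t, ht0, htc, ?_, ?_⟩
  · simp only [map_add, map_smul, LinearMap.add_apply, LinearMap.smul_apply, smul_eq_mul, hP y x]
    linear_combination ht
  · simp only [map_add, map_smul, LinearMap.add_apply, LinearMap.smul_apply, smul_eq_mul, hP y x]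
    intro h
    nlinarith [mul_nonneg (sq_nonneg t) (neg_nonneg.mpr hy.le)]

/-- If every zero of `q_P` in the cone `q_A > 0` lies in the kernel of `P`, then `q_P` does not
change sign on that cone. -/
lemma not_sign_change_on_pos_cone {A P : LinearMap.BilinForm ℝ E} (hA : ∀ u v, A u v = A v u)
    (hP : ∀ u v, P u v = P v u) (h : ∀ z, 0 < A z z → P z z = 0 → ∀ v, P z v = 0)
    {x y : E} (hAx : 0 < A x x) (hAy : 0 < A y y) (hx : 0 < P x x) : 0 ≤ P y y := by
  by_contra! hy
  obtain ⟨t, ht0, htc, hz, hzx⟩ := exists_isotropic_add_smul hP hx hy (A x y)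
  refine hzx (h _ ?_ hz x)
  simp only [map_add, map_smul, LinearMap.add_apply, LinearMap.smul_apply, smul_eq_mul, hA y x]
  nlinarith [mul_nonneg (mul_self_nonneg t) hAy.le]

/-- Nestedness of the sublevel sets at a positive level. -/
lemma nested_of_pos_level {A B : LinearMap.BilinForm ℝ E} (hA : ∀ u v, A u v = A v u)
    (hB : ∀ u v, B u v = B v u) {r : ℝ} (hr : 0 < r) {w : E} (hAw : 0 < A w w) (hBw : 0 < B w w)
    (h : ∀ z, A z z = r → B z z = r →
      ∃ s t : ℝ, (s ≠ 0 ∨ t ≠ 0) ∧ ∀ v, s * A z v + t * B z v = 0) :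
    (∀ x, A x x ≤ r → B x x ≤ r) ∨ (∀ x, B x x ≤ r → A x x ≤ r) := by
  have hP : ∀ u v, (B - A) u v = (B - A) v u := fun u v => by
    simp only [LinearMap.sub_apply, hA u v, hB u v]
  have key : ∀ z, 0 < A z z → (B - A) z z = 0 → ∀ v, (B - A) z v = 0 := by
    intro z hz hPz v
    simp only [LinearMap.sub_apply] at hPz ⊢
    have hz' : B z z = A z z := by linarith
    set c : ℝ := √(r / A z z) with hc
    have hc0 : 0 < c := Real.sqrt_pos.mpr (by positivity)
    have hcz : c * c * A z z = r := by
      rw [hc, Real.mul_self_sqrt (by positivity)]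
      field_simp
    obtain ⟨s, t, hst, hdep⟩ := h (c • z)
      (by simp only [map_smul, LinearMap.smul_apply, smul_eq_mul]; linarith)
      (by simp only [map_smul, LinearMap.smul_apply, smul_eq_mul, hz']; linarith)
    have h1 : s + t = 0 := by
      have := hdep (c • z)
      simp only [map_smul, LinearMap.smul_apply, smul_eq_mul, hz'] at this
      have h2 : (s + t) * r = 0 := by linear_combination this - (s + t) * hcz
      exact (mul_eq_zero.mp h2).resolve_right hr.ne'
    have ht : t ≠ 0 := by
      rintro rfl
      simp_all
    have h3 := hdep v
    simp only [map_smul, LinearMap.smul_apply, smul_eq_mul] at h3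
    have h4 : (t * c) * (B z v - A z v) = 0 := by linear_combination h3 - c * A z v * h1
    exact (mul_eq_zero.mp h4).resolve_left (mul_ne_zero ht hc0.ne')
  have key' : ∀ z, 0 < B z z → (B - A) z z = 0 → ∀ v, (B - A) z v = 0 := fun z hz hPz =>
    key z (by simp only [LinearMap.sub_apply] at hPz; linarith) hPz
  by_contra! hcon
  obtain ⟨⟨x, hAx, hBx⟩, y, hBy, hAy⟩ := hcon
  have hPx : 0 < (B - A) x x := by simp only [LinearMap.sub_apply]; linarith
  have hPy : (B - A) y y < 0 := by simp only [LinearMap.sub_apply]; linarith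
  have hnonneg : 0 ≤ (B - A) w w :=
    not_sign_change_on_pos_cone hB hP key' (hr.trans hBx) hBw hPx
  have hnonpos : ∀ v, 0 < A v v → (B - A) v v ≤ 0 := by
    intro v hv
    by_contra! hv'
    exact hPy.not_ge (not_sign_change_on_pos_cone hA hP key hv (hr.trans hAy) hv')
  have hker : ∀ v, (B - A) v w = 0 := fun v =>
    (hP v w).trans (key w hAw (le_antisymm (hnonpos w hAw) hnonneg) v)
  obtain ⟨s, hs⟩ := exists_pos_quadratic hAw (A x x) (A x w)
  have hle := hnonpos (x + s • w) (by
    simp only [map_add, map_smul, LinearMap.add_apply, LinearMap.smul_apply, smul_eq_mul, hA w x]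
    linarith)
  have heq : (B - A) (x + s • w) (x + s • w) = (B - A) x x := by
    rw [map_add, map_smul, hker (x + s • w), hP _ x, map_add, map_smul, hker x, smul_zero,
      add_zero, add_zero]
  linarith

/-- The forms `A` and `B` have no common isotropic vector at which they are transversal. -/
def NoTransversalIsotropic (A B : LinearMap.BilinForm ℝ E) : Prop :=
  ∀ z, A z z = 0 → B z z = 0 → ∃ s t : ℝ, (s ≠ 0 ∨ t ≠ 0) ∧ ∀ v, s * A z v + t * B z v = 0

lemma NoTransversalIsotropic.not_sign_change_of_orthogonal {A B : LinearMap.BilinForm ℝ E}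
    (h : NoTransversalIsotropic A B) (hA : ∀ u v, A u v = A v u) (hB : ∀ u v, B u v = B v u)
    {x y v : E} (hAx : A x x = 0) (hAy : A y y = 0) (hAxy : A x y = 0) (hxv : A x v ≠ 0)
    (hBx : 0 < B x x) : 0 ≤ B y y := by
  by_contra! hBy
  have key : ∀ c : ℝ, ∃ t ≠ 0, 0 ≤ t * c ∧ A x v + t * A y v = 0 := by
    intro c
    obtain ⟨t, ht0, htc, hz, hzx⟩ := exists_isotropic_add_smul hB hBx hBy c
    refine ⟨t, ht0, htc, ?_⟩
    obtain ⟨p, q, hpq, hdep⟩ := h (x + t • y) (by simp [hA y x, hAx, hAy, hAxy]) hz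
    have hzero : A (x + t • y) x = 0 := by simp [hA y x, hAx, hAxy]
    have hq : q = 0 := by
      have := hdep x
      rw [hzero, mul_zero, zero_add] at this
      exact (mul_eq_zero.mp this).resolve_right hzx
    have hp : p ≠ 0 := by simpa [hq] using hpq
    simpa [hq, hp] using hdep v
  obtain ⟨t, ht0, htc, ht⟩ := key 1
  obtain ⟨u, hu0, huc, hu⟩ := key (-1)
  have htu : t - u ≠ 0 := by
    have : 0 < t := lt_of_le_of_ne (by linarith) ht0.symm
    linarith
  have : (t - u) * A y v = 0 := by linear_combination ht - hu
  have hy : A y v = 0 := (mul_eq_zero.mp this).resolve_left htu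
  exact hxv (by simpa [hy] using ht)

/-- A plane on which `A` is positive definite yields a positive vector orthogonal to a given
hyperbolic pair. -/
lemma exists_pos_orthogonal_hyperbolic {A : LinearMap.BilinForm ℝ E} (hA : ∀ u v, A u v = A v u)
    {V : Submodule ℝ E} (hV : Module.finrank ℝ V = 2) (hpos : ∀ v ∈ V, v ≠ 0 → 0 < A v v)
    {x y : E} (hAx : A x x = 0) (hAxy : A x y ≠ 0) :
    ∃ w, 0 < A w w ∧ A x w = 0 ∧ A y w = 0 := by
  have : Module.Finite ℝ V := Module.finite_of_finrank_pos (by omega)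
  obtain ⟨v, hv, hv0⟩ : ∃ v ∈ LinearMap.ker ((A x).domRestrict V), v ≠ 0 := by
    refine Submodule.exists_mem_ne_zero_of_ne_bot (LinearMap.ker_ne_bot_of_finrank_lt ?_)
    simp [hV]
  have hxv : A x v = 0 := hv
  have hvpos := hpos v v.2 (by simpa using hv0)
  refine ⟨(v : E) - (A y v / A x y) • x, ?_, ?_, ?_⟩
  · simpa [hA v x, hxv, hAx] using hvpos
  · simp [hxv, hAx]
  · simp [hA y x, hAxy]

lemma NoTransversalIsotropic.not_sign_change_of_hyperbolic {A B : LinearMap.BilinForm ℝ E}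
    (h : NoTransversalIsotropic A B) (hA : ∀ u v, A u v = A v u) (hB : ∀ u v, B u v = B v u)
    {x y w : E} (hAx : A x x = 0) (hAy : A y y = 0) (hAxy : A x y < 0) (hw : 0 < A w w)
    (hxw : A x w = 0) (hyw : A y w = 0) (hBx : 0 < B x x) : 0 ≤ B y y := by
  by_contra! hBy
  obtain ⟨c, hc⟩ : ∃ c : ℝ, c * c * A w w = -2 * A x y := by
    refine ⟨√(-2 * A x y / A w w), ?_⟩
    rw [Real.mul_self_sqrt (div_nonneg (by linarith) hw.le)]
    field_simp
  obtain ⟨t, ht0, hroot, hsimple⟩ := exists_simple_root_quartic hBx hBy (2 * (c * B x w))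
    (c * c * B w w + 2 * B x y) (2 * (c * B y w))
  set z : E := x + (t * c) • w + (t ^ 2) • y with hz
  obtain ⟨p, q, hpq, hdep⟩ := h z
    (by
      simp only [hz, map_add, map_smul, LinearMap.add_apply, LinearMap.smul_apply, smul_eq_mul,
        hA y x, hA w x, hA w y, hxw, hyw, hAx, hAy]
      linear_combination t ^ 2 * hc)
    (by
      simp only [hz, map_add, map_smul, LinearMap.add_apply, LinearMap.smul_apply, smul_eq_mul,
        hB y x, hB w x, hB w y]
      linear_combination hroot)
  have htangent : A z (c • w + (2 * t) • y) = 0 := by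
    simp only [hz, map_add, map_smul, LinearMap.add_apply, LinearMap.smul_apply, smul_eq_mul,
      hA w y, hxw, hyw, hAy]
    linear_combination t * hc
  have hderiv : B z (c • w + (2 * t) • y) ≠ 0 := by
    refine fun h0 => hsimple ?_
    simp only [hz, map_add, map_smul, LinearMap.add_apply, LinearMap.smul_apply, smul_eq_mul,
      hB w y] at h0
    linear_combination 2 * h0
  have hzx : A z x ≠ 0 := by
    simp [hz, hAx, hA w x, hxw, hA y x, ht0, hAxy.ne]
  have hq : q = 0 := by
    have := hdep (c • w + (2 * t) • y)
    rw [htangent, mul_zero, zero_add] at this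
    exact (mul_eq_zero.mp this).resolve_right hderiv
  have hp : p = 0 := by simpa [hq, hzx] using hdep x
  simp [hp, hq] at hpq

lemma NoTransversalIsotropic.not_sign_change {A B : LinearMap.BilinForm ℝ E}
    (h : NoTransversalIsotropic A B) (hA : ∀ u v, A u v = A v u) (hB : ∀ u v, B u v = B v u)
    {V : Submodule ℝ E} (hV : Module.finrank ℝ V = 2) (hpos : ∀ v ∈ V, v ≠ 0 → 0 < A v v)
    {u v : E} (hAu : A u u = 0) (huv : A u v ≠ 0)
    {x y : E} (hAx : A x x = 0) (hAy : A y y = 0) (hBx : 0 < B x x) : 0 ≤ B y y := by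
  rcases eq_or_ne (A x y) 0 with hAxy | hAxy
  · by_cases hx : ∃ v, A x v ≠ 0
    · obtain ⟨v, hv⟩ := hx
      exact h.not_sign_change_of_orthogonal hA hB hAx hAy hAxy hv hBx
    push Not at hx
    obtain ⟨u', v', hu', huv', huy'⟩ : ∃ u' v', A u' u' = 0 ∧ A u' v' ≠ 0 ∧ A u' y = 0 := by
      by_cases hy : ∃ v, A y v ≠ 0
      · obtain ⟨v, hv⟩ := hy
        exact ⟨y, v, hAy, hv, hAy⟩
      · push Not at hy
        exact ⟨u, v, hAu, huv, by rw [hA, hy]⟩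
    obtain ⟨s, hs⟩ := exists_pos_quadratic hBx (B u' u') (B u' x)
    refine h.not_sign_change_of_orthogonal (x := u' + s • x) (v := v') hA hB ?_ hAy ?_ ?_ ?_
    · simp [hx, hA u' x, hu']
    · simp [hx, huy']
    · simpa [hx] using huv'
    · simp only [map_add, map_smul, LinearMap.add_apply, LinearMap.smul_apply, smul_eq_mul,
        hB x u']
      linarith
  · obtain ⟨w, hw, hxw, hyw⟩ := exists_pos_orthogonal_hyperbolic hA hV hpos hAx hAxy
    rcases hAxy.lt_or_gt with hlt | hgt
    · exact h.not_sign_change_of_hyperbolic hA hB hAx hAy hlt hw hxw hyw hBx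
    · simpa using h.not_sign_change_of_hyperbolic (y := -y) hA hB hAx (by simpa using hAy)
        (by simpa using hgt) hw hxw (by simpa using hyw) hBx

/-- If `q_B ≤ 0` on the zero cone of `q_A` and `q_A`, `q_B` are both positive somewhere, then
`q_A ≤ 0` implies `q_B ≤ 0`. -/
lemma nonpos_of_nonpos_on_isotropic {A B : LinearMap.BilinForm ℝ E} (hA : ∀ u v, A u v = A v u)
    (hB : ∀ u v, B u v = B v u) {w : E} (hAw : 0 < A w w) (hBw : 0 < B w w)
    (h : ∀ z, A z z = 0 → B z z ≤ 0) {x : E} (hx : A x x ≤ 0) : B x x ≤ 0 := by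
  rcases hx.eq_or_lt with hx | hx
  · exact h x hx
  by_contra! hBx
  obtain ⟨t, ht0, htc, hz, -⟩ := exists_isotropic_add_smul hA hAw hx (B w x)
  have := h _ hz
  simp only [map_add, map_smul, LinearMap.add_apply, LinearMap.smul_apply, smul_eq_mul,
    hB x w] at this
  nlinarith [mul_nonneg (mul_self_nonneg t) hBx.le]

/-- If `q_B ≥ 0` on the zero cone of `q_A` and `q_A`, `q_B` are both negative somewhere, then
`q_B ≤ 0` implies `q_A ≤ 0`. -/
lemma nonpos_of_nonneg_on_isotropic {A B : LinearMap.BilinForm ℝ E} (hA : ∀ u v, A u v = A v u)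
    (hB : ∀ u v, B u v = B v u) {w : E} (hAw : A w w < 0) (hBw : B w w < 0)
    (h : ∀ z, A z z = 0 → 0 ≤ B z z) {y : E} (hy : B y y ≤ 0) : A y y ≤ 0 := by
  by_contra! hAy
  obtain ⟨t, ht0, htc, hz, -⟩ := exists_isotropic_add_smul hA hAy hAw (-B y w)
  have := h _ hz
  simp only [map_add, map_smul, LinearMap.add_apply, LinearMap.smul_apply, smul_eq_mul,
    hB w y] at this
  nlinarith [mul_pos (mul_self_pos.mpr ht0) (neg_pos.mpr hBw)]

/-- Nestedness of the sublevel sets at level zero. -/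
lemma NoTransversalIsotropic.nested {A B : LinearMap.BilinForm ℝ E}
    (h : NoTransversalIsotropic A B) (hA : ∀ u v, A u v = A v u) (hB : ∀ u v, B u v = B v u)
    {V : Submodule ℝ E} (hV : Module.finrank ℝ V = 2) (hpos : ∀ v ∈ V, v ≠ 0 → 0 < A v v)
    {u v : E} (hAu : A u u = 0) (huv : A u v ≠ 0)
    {w₁ : E} (hAw₁ : 0 < A w₁ w₁) (hBw₁ : 0 < B w₁ w₁)
    {w₂ : E} (hAw₂ : A w₂ w₂ < 0) (hBw₂ : B w₂ w₂ < 0) :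
    (∀ x, A x x ≤ 0 → B x x ≤ 0) ∨ (∀ x, B x x ≤ 0 → A x x ≤ 0) := by
  by_cases hsign : ∃ x, A x x = 0 ∧ 0 < B x x
  · obtain ⟨x, hAx, hBx⟩ := hsign
    exact .inr fun y hy => nonpos_of_nonneg_on_isotropic hA hB hAw₂ hBw₂
      (fun z hz => h.not_sign_change hA hB hV hpos hAu huv hAx hz hBx) hy
  · push Not at hsign
    exact .inl fun x hx => nonpos_of_nonpos_on_isotropic hA hB hAw₁ hBw₁ hsign hx

/-- A symmetric form with a non-radical isotropic vector takes a negative value. -/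
lemma exists_neg_of_isotropic {A : LinearMap.BilinForm ℝ E} (hA : ∀ u v, A u v = A v u)
    {u v : E} (hAu : A u u = 0) (huv : A u v ≠ 0) : ∃ w, A w w < 0 := by
  refine ⟨v - ((A v v + 1) / (2 * A u v)) • u, ?_⟩
  have : A (v - ((A v v + 1) / (2 * A u v)) • u) (v - ((A v v + 1) / (2 * A u v)) • u) = -1 := by
    simp only [map_sub, map_smul, LinearMap.sub_apply, LinearMap.smul_apply, smul_eq_mul, hA v u,
      hAu]
    field_simp
    ring
  linarith

end BilinForm

lemma continuous_dotProduct_mulVec_self {n : ℕ} (M : Matrix (Fin n) (Fin n) ℝ) :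
    Continuous fun x : Fin n → ℝ => x ⬝ᵥ M.mulVec x :=
  continuous_id.dotProduct (continuous_const.matrix_mulVec continuous_id)

lemma toBilin'_apply_comm {n : ℕ} {M : Matrix (Fin n) (Fin n) ℝ} (hM : M.IsSymm) (u v : Fin n → ℝ) :
    M.toBilin' u v = M.toBilin' v u := by
  rw [Matrix.toBilin'_apply', Matrix.toBilin'_apply', Matrix.dotProduct_mulVec,
    ← Matrix.mulVec_transpose, hM.eq, dotProduct_comm]

/-- If `q_M` is positive somewhere, its level sets lie in the frontier of the sublevel sets. -/
lemma mem_frontier_sublevel {n : ℕ} {M : Matrix (Fin n) (Fin n) ℝ} (hM : M.IsSymm)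
    {w : Fin n → ℝ} (hw : 0 < w ⬝ᵥ M.mulVec w) {r : ℝ} {z : Fin n → ℝ}
    (hz : z ⬝ᵥ M.mulVec z = r) : z ∈ frontier {x : Fin n → ℝ | x ⬝ᵥ M.mulVec x ≤ r} := by
  have hclosed : IsClosed {x : Fin n → ℝ | x ⬝ᵥ M.mulVec x ≤ r} :=
    isClosed_le (continuous_dotProduct_mulVec_self M) continuous_const
  rw [hclosed.frontier_eq]
  refine ⟨hz.le, fun hint => ?_⟩
  obtain ⟨ε, hε, hεpos⟩ : ∃ ε : ℝ, 0 ≤ ε * M.toBilin' z w ∧ ε ≠ 0 := by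
    rcases le_total 0 (M.toBilin' z w) with h | h
    · exact ⟨1, by linarith, one_ne_zero⟩
    · exact ⟨-1, by linarith, by norm_num⟩
  have hcont : Filter.Tendsto (fun t : ℝ => z + (t * ε) • w) (nhdsWithin 0 (Set.Ioi 0))
      (nhds z) := by
    have : Continuous fun t : ℝ => z + (t * ε) • w := by fun_prop
    simpa using (this.tendsto 0).mono_left nhdsWithin_le_nhds
  obtain ⟨t, ht, htpos⟩ :=
    ((hcont.eventually (mem_interior_iff_mem_nhds.mp hint)).and self_mem_nhdsWithin).exists
  have ht' : (z + (t * ε) • w) ⬝ᵥ M.mulVec (z + (t * ε) • w) ≤ r := ht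
  have htpos' : 0 < t := htpos
  rw [← Matrix.toBilin'_apply'] at ht' hz hw
  simp only [map_add, map_smul, LinearMap.add_apply, LinearMap.smul_apply, smul_eq_mul,
    toBilin'_apply_comm hM w z] at ht'
  have h1 : 0 ≤ t * (ε * M.toBilin' z w) := mul_nonneg htpos'.le hε
  have h2 : 0 < (t * ε) * (t * ε) * M.toBilin' w w :=
    mul_pos (mul_self_pos.mpr (mul_ne_zero htpos'.ne' hεpos)) hw
  nlinarith

/-- Strict inequalities for `q_M` at a fixed vector persist under small entrywise perturbations. -/
lemma exists_entrywise_ball {n : ℕ} (M : Matrix (Fin n) (Fin n) ℝ) (w : Fin n → ℝ)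
    {U : Set ℝ} (hU : IsOpen U) (hM : w ⬝ᵥ M.mulVec w ∈ U) :
    ∃ δ > 0, ∀ N : Matrix (Fin n) (Fin n) ℝ, (∀ i j, |N i j - M i j| < δ) →
      w ⬝ᵥ N.mulVec w ∈ U := by
  have hcont : Continuous fun N : Fin n → Fin n → ℝ => w ⬝ᵥ (Matrix.of N).mulVec w := by
    simp only [dotProduct, Matrix.mulVec, Matrix.of_apply]
    fun_prop
  obtain ⟨δ, hδ, hball⟩ := Metric.isOpen_iff.mp (hU.preimage hcont) (Matrix.of.symm M) hM
  refine ⟨δ, hδ, fun N hN => hball (a := Matrix.of.symm N) ?_⟩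
  rw [Metric.mem_ball, dist_pi_lt_iff hδ]
  exact fun i => (dist_pi_lt_iff hδ).mpr fun j => hN i j

lemma exists_dependency_of_not_linearIndependent {n : ℕ} {A B : Matrix (Fin n) (Fin n) ℝ}
    (hA : A.IsSymm) (hB : B.IsSymm) {z : Fin n → ℝ}
    (h : ¬ LinearIndependent ℝ ![A.mulVec z, B.mulVec z]) :
    ∃ s t : ℝ, (s ≠ 0 ∨ t ≠ 0) ∧ ∀ v, s * A.toBilin' z v + t * B.toBilin' z v = 0 := by
  rw [LinearIndependent.pair_iff] at h
  push Not at h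
  obtain ⟨s, t, hst, hne⟩ := h
  refine ⟨s, t, ?_, fun v => ?_⟩
  · by_contra! h0
    exact hne h0.1 h0.2
  · rw [toBilin'_apply_comm hA z, toBilin'_apply_comm hB z, Matrix.toBilin'_apply', Matrix.toBilin'_apply',
      ← smul_eq_mul, ← smul_eq_mul, ← dotProduct_smul, ← dotProduct_smul, ← dotProduct_add, hst,
      dotProduct_zero]

/-- **Theorem 2.6.** Let `W` be a nontrivial subspace of `Sym(n,ℝ)`, `r ≥ 0`,
and let `A ∈ W` have maximal rank in `W` with at least `2` positive eigenvalues (expressed by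
the existence of a `2`-dimensional subspace on which `Q_A` is positive definite). Assume
`∂Γ_A^r` is an `(n−1)`-dimensional variety (there is `z ∈ ∂Γ_A^r` with `Az ≠ 0`). Then there
is `δ > 0` such that for every `B ∈ W` with `‖B − A‖ < δ` (entrywise): if `∂Γ_B^r` is an
`(n−1)`-dimensional variety and the boundaries `∂Γ_A^r`, `∂Γ_B^r` do not intersect
transversally anywhere, then `Γ_A^r ⊆ Γ_B^r` or `Γ_B^r ⊆ Γ_A^r`. -/
theorem sublevel_nested_of_no_transversal_perturb {n : ℕ}
    (W : Submodule ℝ (Matrix (Fin n) (Fin n) ℝ)) (hW : W ≠ ⊥)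
    (hWsymm : ∀ F ∈ W, F.IsSymm)
    (r : ℝ) (hr : 0 ≤ r)
    (A : Matrix (Fin n) (Fin n) ℝ) (hA : A ∈ W)
    (hmax : ∀ F ∈ W, F.rank ≤ A.rank)
    (hpos2 : ∃ V : Submodule ℝ (Fin n → ℝ), Module.finrank ℝ V = 2 ∧
      ∀ x ∈ V, x ≠ 0 → 0 < x ⬝ᵥ A.mulVec x)
    (hvarA : ∃ z ∈ frontier {x : Fin n → ℝ | x ⬝ᵥ A.mulVec x ≤ r}, A.mulVec z ≠ 0) :
    ∃ δ > (0 : ℝ), ∀ B ∈ W, (∀ i j, |B i j - A i j| < δ) →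
      (∃ z' ∈ frontier {x : Fin n → ℝ | x ⬝ᵥ B.mulVec x ≤ r}, B.mulVec z' ≠ 0) →
      (∀ z ∈ frontier {x : Fin n → ℝ | x ⬝ᵥ A.mulVec x ≤ r} ∩
             frontier {x : Fin n → ℝ | x ⬝ᵥ B.mulVec x ≤ r},
        ¬ LinearIndependent ℝ ![A.mulVec z, B.mulVec z]) →
      ({x : Fin n → ℝ | x ⬝ᵥ A.mulVec x ≤ r} ⊆ {x : Fin n → ℝ | x ⬝ᵥ B.mulVec x ≤ r} ∨
       {x : Fin n → ℝ | x ⬝ᵥ B.mulVec x ≤ r} ⊆ {x : Fin n → ℝ | x ⬝ᵥ A.mulVec x ≤ r}) := by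
  obtain ⟨V, hV, hpos⟩ := hpos2
  have hAs := toBilin'_apply_comm (hWsymm A hA)
  obtain ⟨w, hwV, hw0⟩ : ∃ w ∈ V, w ≠ 0 :=
    Submodule.exists_mem_ne_zero_of_ne_bot (by rintro rfl; simp at hV)
  have hAw := hpos w hwV hw0
  obtain ⟨δ₁, hδ₁, hball₁⟩ := exists_entrywise_ball A w isOpen_Ioi hAw
  have hdep : ∀ B ∈ W, (0 < w ⬝ᵥ B.mulVec w) →
      (∀ z ∈ frontier {x : Fin n → ℝ | x ⬝ᵥ A.mulVec x ≤ r} ∩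
             frontier {x : Fin n → ℝ | x ⬝ᵥ B.mulVec x ≤ r},
        ¬ LinearIndependent ℝ ![A.mulVec z, B.mulVec z]) →
      ∀ z, A.toBilin' z z = r → B.toBilin' z z = r →
        ∃ s t : ℝ, (s ≠ 0 ∨ t ≠ 0) ∧ ∀ v, s * A.toBilin' z v + t * B.toBilin' z v = 0 := by
    intro B hB hBw hnt z hAz hBz
    rw [Matrix.toBilin'_apply'] at hAz hBz
    exact exists_dependency_of_not_linearIndependent (hWsymm A hA) (hWsymm B hB)
      (hnt z ⟨mem_frontier_sublevel (hWsymm A hA) hAw hAz,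
        mem_frontier_sublevel (hWsymm B hB) hBw hBz⟩)
  rcases hr.eq_or_lt with rfl | hr
  · obtain ⟨u, hu, hAu⟩ := hvarA
    have hu0 : A.toBilin' u u = 0 := by
      rw [Matrix.toBilin'_apply']
      exact frontier_le_subset_eq (continuous_dotProduct_mulVec_self A) continuous_const hu
    have huv : A.toBilin' u (A.mulVec u) ≠ 0 := by
      rw [hAs, Matrix.toBilin'_apply']
      exact fun h => hAu (dotProduct_self_eq_zero.mp h)
    obtain ⟨w', hAw'⟩ := exists_neg_of_isotropic hAs hu0 huv
    rw [Matrix.toBilin'_apply'] at hAw'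
    obtain ⟨δ₂, hδ₂, hball₂⟩ := exists_entrywise_ball A w' isOpen_Iio hAw'
    refine ⟨min δ₁ δ₂, lt_min hδ₁ hδ₂, fun B hB hBA _ hnt => ?_⟩
    have hBw : 0 < w ⬝ᵥ B.mulVec w :=
      hball₁ B fun i j => (hBA i j).trans_le (min_le_left _ _)
    have hBw' : w' ⬝ᵥ B.mulVec w' < 0 :=
      hball₂ B fun i j => (hBA i j).trans_le (min_le_right _ _)
    have hno : NoTransversalIsotropic A.toBilin' B.toBilin' := hdep B hB hBw hnt
    simpa only [Matrix.toBilin'_apply', Set.ofPred_subset_ofPred] using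
      hno.nested (w₁ := w) (w₂ := w') hAs (toBilin'_apply_comm (hWsymm B hB)) hV
        (by simpa only [Matrix.toBilin'_apply'] using hpos) hu0 huv
        (by rwa [Matrix.toBilin'_apply']) (by rwa [Matrix.toBilin'_apply'])
        (by rwa [Matrix.toBilin'_apply']) (by rwa [Matrix.toBilin'_apply'])
  · refine ⟨δ₁, hδ₁, fun B hB hBA _ hnt => ?_⟩
    have hBw : 0 < w ⬝ᵥ B.mulVec w := hball₁ B hBA
    simpa only [Matrix.toBilin'_apply', Set.ofPred_subset_ofPred] using
      nested_of_pos_level (w := w) hAs (toBilin'_apply_comm (hWsymm B hB)) hr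
        (by rwa [Matrix.toBilin'_apply']) (by rwa [Matrix.toBilin'_apply'])
        (hdep B hB hBw hnt)
end

section
/- Let A, B ∈ Sym(n,ℝ) be a non-dissipative pair with maxrank{A,B} ≥ 3. If A and B are linearly independent, then there exists a point z ∈ ℝⁿ with Q_A(z) = 0, Q_B(z) = 0, and such that the vectors Az and Bz are linearly independent. -/
open Matrix

/-- A real quadratic polynomial with positive constant and negative leading coefficient has a
negative and a positive root. -/
lemma exists_neg_pos_roots {p q : ℝ} (b : ℝ) (hp : 0 < p) (hq : q < 0) :
    ∃ t₁ t₂ : ℝ, t₁ < 0 ∧ 0 < t₂ ∧ p + 2 * t₁ * b + t₁ ^ 2 * q = 0 ∧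
      p + 2 * t₂ * b + t₂ ^ 2 * q = 0 ∧ t₁ * t₂ * q = p := by
  have hpq : p * q < 0 := mul_neg_of_pos_of_neg hp hq
  have hd : 0 ≤ b ^ 2 - p * q := by nlinarith [sq_nonneg b]
  set r := √(b ^ 2 - p * q) with hr
  have hr2 : r ^ 2 = b ^ 2 - p * q := Real.sq_sqrt hd
  have hbr : |b| < r := by
    rw [hr]
    apply Real.lt_sqrt_of_sq_lt
    rw [sq_abs]
    linarith
  obtain ⟨h₁, h₂⟩ := abs_lt.1 hbr
  have hq0 : q ≠ 0 := hq.ne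
  refine ⟨(-b + r) / q, (-b - r) / q, div_neg_of_pos_of_neg (by linarith) hq,
    div_pos_of_neg_of_neg (by linarith) hq, ?_, ?_, ?_⟩
  all_goals
    field_simp
    linarith

section BilinForm

variable {V : Type*} [AddCommGroup V] [Module ℝ V]

/-- The **S-lemma** for an indefinite quadratic form `F`: if `G` is nonnegative on the null cone
of `F`, then some `G + c F` is positive semidefinite. -/
lemma exists_add_mul_nonneg {F G : LinearMap.BilinForm ℝ V}
    (hF : ∀ x y, F x y = F y x) (hG : ∀ x y, G x y = G y x)
    (hpos : ∃ u, 0 < F u u) (hneg : ∃ v, F v v < 0)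
    (h : ∀ x, F x x = 0 → 0 ≤ G x x) : ∃ c : ℝ, ∀ x, 0 ≤ G x x + c * F x x := by
  have key : ∀ u v, 0 < F u u → F v v < 0 → -(G u u) / F u u ≤ G v v / -(F v v) := by
    intro u v hu hv
    obtain ⟨t₁, t₂, ht₁, ht₂, e₁, e₂, e₃⟩ := exists_neg_pos_roots (F u v) hu hv
    have n : ∀ t : ℝ, F u u + 2 * t * F u v + t ^ 2 * F v v = 0 →
        0 ≤ G u u + 2 * t * G u v + t ^ 2 * G v v := by
      intro t ht
      have := h (u + t • v) (by
        simp only [map_add, map_smul, LinearMap.add_apply, LinearMap.smul_apply, smul_eq_mul]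
        rw [hF v u]; linarith)
      simp only [map_add, map_smul, LinearMap.add_apply, LinearMap.smul_apply, smul_eq_mul] at this
      rw [hG v u] at this; linarith
    have g₁ := mul_nonneg ht₂.le (n t₁ e₁)
    have g₂ := mul_nonneg (neg_pos.2 ht₁).le (n t₂ e₂)
    have g₃ : 0 ≤ (t₂ - t₁) * (G u u - t₁ * t₂ * G v v) := by linarith
    have g₄ : 0 ≤ G u u - t₁ * t₂ * G v v := nonneg_of_mul_nonneg_right g₃ (by linarith)
    rw [div_le_div_iff₀ hu (neg_pos.2 hv)]
    have g₅ := mul_nonneg g₄ (neg_pos.2 hv).le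
    rw [← e₃] at *
    linarith
  obtain ⟨u₀, hu₀⟩ := hpos
  obtain ⟨v₀, hv₀⟩ := hneg
  obtain ⟨c, hc₁, hc₂⟩ := exists_between_of_forall_le
    (s := {r | ∃ u, 0 < F u u ∧ r = -(G u u) / F u u})
    (t := {r | ∃ v, F v v < 0 ∧ r = G v v / -(F v v)}) ⟨_, u₀, hu₀, rfl⟩ ⟨_, v₀, hv₀, rfl⟩
    (by rintro _ ⟨u, hu, rfl⟩ _ ⟨v, hv, rfl⟩; exact key u v hu hv)
  refine ⟨c, fun x => ?_⟩
  rcases lt_trichotomy (F x x) 0 with hx | hx | hx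
  · have := hc₂ ⟨x, hx, rfl⟩
    rw [le_div_iff₀ (neg_pos.2 hx)] at this
    linarith
  · rw [hx]; simpa using h x hx
  · have := hc₁ ⟨x, hx, rfl⟩
    rw [div_le_iff₀ hx] at this
    linarith

/-- The null vectors of an indefinite form outside its kernel are not contained in a
hyperplane. -/
lemma exists_null_apply_ne_zero {F : LinearMap.BilinForm ℝ V}
    (hF : ∀ x y, F x y = F y x) (hpos : ∃ u, 0 < F u u) (hneg : ∃ v, F v v < 0)
    {l : V →ₗ[ℝ] ℝ} (hl : l ≠ 0) : ∃ x, F x x = 0 ∧ F x ≠ 0 ∧ l x ≠ 0 := by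
  by_contra! hcon
  have key : ∀ u v, 0 < F u u → F v v < 0 → l u = 0 ∧ l v = 0 := by
    intro u v hu hv
    obtain ⟨t₁, t₂, ht₁, ht₂, e₁, e₂, -⟩ := exists_neg_pos_roots (F u v) hu hv
    have n : ∀ t : ℝ, F u u + 2 * t * F u v + t ^ 2 * F v v = 0 → l u + t * l v = 0 := by
      intro t ht
      have h0 : F (u + t • v) (u + t • v) = 0 := by
        simp only [map_add, map_smul, LinearMap.add_apply, LinearMap.smul_apply, smul_eq_mul]
        rw [hF v u]; linarith
      have h1 : F (u + t • v) ≠ 0 := by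
        intro h
        have hu' := LinearMap.congr_fun h u
        have hv' := LinearMap.congr_fun h v
        simp only [map_add, map_smul, LinearMap.add_apply, LinearMap.smul_apply, smul_eq_mul,
          LinearMap.zero_apply] at hu' hv'
        rw [hF v u] at hu'
        have : F u u = t ^ 2 * F v v := by linear_combination hu' - t * hv'
        nlinarith [sq_nonneg t]
      simpa using hcon _ h0 h1
    have a₁ := n t₁ e₁
    have a₂ := n t₂ e₂
    have hv0 : l v = 0 := by
      have : (t₂ - t₁) * l v = 0 := by linear_combination a₂ - a₁
      exact (mul_eq_zero.1 this).resolve_left (by linarith)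
    exact ⟨by simpa [hv0] using a₁, hv0⟩
  obtain ⟨u, hu⟩ := hpos
  obtain ⟨v, hv⟩ := hneg
  apply hl
  ext w
  rw [LinearMap.zero_apply]
  rcases lt_trichotomy (F w w) 0 with hw | hw | hw
  · exact (key u w hu hw).2
  · by_cases hk : F w = 0
    · have hsum : 0 < F (u + w) (u + w) := by
        simpa [hF u w, hk] using hu
      have := (key _ v hsum hv).1
      rw [map_add, (key u v hu hv).1, zero_add] at this
      exact this
    · exact hcon w hw hk
  · exact (key w v hw hv).1

/-- A transversal common zero of a basis of a pencil is one of the original pair. -/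
lemma exists_transversal_of_rotate {F G : LinearMap.BilinForm ℝ V} {s t : ℝ}
    (h : ∃ z, (s • F + t • G) z z = 0 ∧ (-t • F + s • G) z z = 0 ∧
      LinearIndependent ℝ ![(s • F + t • G) z, (-t • F + s • G) z]) :
    ∃ z, F z z = 0 ∧ G z z = 0 ∧ LinearIndependent ℝ ![F z, G z] := by
  obtain ⟨z, h₁, h₂, h₃⟩ := h
  rw [LinearIndependent.pair_iff] at h₃
  have hst : s ^ 2 + t ^ 2 ≠ 0 := by
    intro h0
    have hs : s = 0 := by nlinarith [sq_nonneg s, sq_nonneg t]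
    have ht : t = 0 := by nlinarith [sq_nonneg s, sq_nonneg t]
    simpa using h₃ 1 0 (by simp [hs, ht])
  simp only [LinearMap.add_apply, LinearMap.smul_apply, smul_eq_mul] at h₁ h₂
  refine ⟨z, ?_, ?_, ?_⟩
  · have : (s ^ 2 + t ^ 2) * F z z = 0 := by linear_combination s * h₁ - t * h₂
    exact (mul_eq_zero.1 this).resolve_left hst
  · have : (s ^ 2 + t ^ 2) * G z z = 0 := by linear_combination t * h₁ + s * h₂
    exact (mul_eq_zero.1 this).resolve_left hst
  · rw [LinearIndependent.pair_iff]
    intro a b hab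
    obtain ⟨e₁, e₂⟩ := h₃ (a * s + b * t) (-a * t + b * s) (by
      have : (a * s + b * t) • (s • F + t • G) z + (-a * t + b * s) • (-t • F + s • G) z =
          (s ^ 2 + t ^ 2) • (a • F z + b • G z) := by
        simp only [LinearMap.add_apply, LinearMap.smul_apply]
        module
      rw [this, hab, smul_zero])
    constructor
    · have : (s ^ 2 + t ^ 2) * a = 0 := by linear_combination s * e₁ - t * e₂
      exact (mul_eq_zero.1 this).resolve_left hst
    · have : (s ^ 2 + t ^ 2) * b = 0 := by linear_combination t * e₁ + s * e₂
      exact (mul_eq_zero.1 this).resolve_left hst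

/-- A null vector of `G` in the kernel of an indefinite form `F`, but not in the kernel of `G`,
can be moved to a transversal common zero. -/
lemma exists_transversal_of_mem_ker {F G : LinearMap.BilinForm ℝ V}
    (hF : ∀ x y, F x y = F y x) (hG : ∀ x y, G x y = G y x)
    (hpos : ∃ u, 0 < F u u) (hneg : ∃ v, F v v < 0)
    {z : V} (hFz : F z = 0) (hGzz : G z z = 0) (hGz : G z ≠ 0) :
    ∃ z, F z z = 0 ∧ G z z = 0 ∧ LinearIndependent ℝ ![F z, G z] := by
  obtain ⟨x, hx, hFx, hzx⟩ := exists_null_apply_ne_zero hF hpos hneg hGz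
  refine ⟨x + (-(G x x) / (2 * G z x)) • z, ?_, ?_, ?_⟩
  · simp [hF x z, hFz, hx]
  · simp only [map_add, map_smul, LinearMap.add_apply, LinearMap.smul_apply, smul_eq_mul,
      hG x z, hGzz]
    field_simp
    ring
  · rw [LinearIndependent.pair_iff]
    intro a b hab
    simp only [map_add, map_smul, hFz, smul_zero, add_zero] at hab
    have h := LinearMap.congr_fun hab z
    simp only [LinearMap.add_apply, LinearMap.smul_apply, smul_eq_mul, hF x z, hFz, hG x z, hGzz,
      LinearMap.zero_apply, mul_zero, zero_add, add_zero] at h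
    have hb : b = 0 := (mul_eq_zero.1 h).resolve_right hzx
    rw [hb, zero_smul, add_zero] at hab
    exact ⟨(smul_eq_zero.1 hab).resolve_right hFx, hb⟩

/-- In a pencil without nonzero positive semidefinite members, a common zero outside the common
kernel yields a transversal common zero. -/
lemma exists_transversal_of_common_zero {F G : LinearMap.BilinForm ℝ V}
    (hF : ∀ x y, F x y = F y x) (hG : ∀ x y, G x y = G y x)
    (hnd : ∀ a b : ℝ, (∀ x, 0 ≤ a * F x x + b * G x x) → a = 0 ∧ b = 0)
    {z : V} (hFzz : F z z = 0) (hGzz : G z z = 0) (hz : ¬(F z = 0 ∧ G z = 0)) :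
    ∃ z, F z z = 0 ∧ G z z = 0 ∧ LinearIndependent ℝ ![F z, G z] := by
  by_cases hli : LinearIndependent ℝ ![F z, G z]
  · exact ⟨z, hFzz, hGzz, hli⟩
  rw [LinearIndependent.pair_iff] at hli
  push Not at hli
  obtain ⟨s, t, hst, hne⟩ := hli
  have hne' : ¬(s = 0 ∧ t = 0) := fun h => hne h.1 h.2
  have hsq : s ^ 2 + t ^ 2 ≠ 0 := by
    intro h0
    exact hne' ⟨by nlinarith [sq_nonneg s, sq_nonneg t], by nlinarith [sq_nonneg s, sq_nonneg t]⟩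
  apply exists_transversal_of_rotate (s := s) (t := t)
  refine exists_transversal_of_mem_ker (z := z) ?_ ?_ ?_ ?_ ?_ ?_ ?_
  · intro x y; simp [hF x y, hG x y]
  · intro x y; simp [hF x y, hG x y]
  · by_contra! h
    have := hnd (-s) (-t) fun x => by
      have := h x
      simp only [LinearMap.add_apply, LinearMap.smul_apply, smul_eq_mul] at this
      linarith
    exact hne' ⟨neg_eq_zero.1 this.1, neg_eq_zero.1 this.2⟩
  · by_contra! h
    exact hne' (hnd s t fun x => by simpa using h x)
  · simpa using hst
  · simp [hFzz, hGzz]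
  · intro h
    simp only [LinearMap.add_apply, LinearMap.smul_apply] at h
    apply hz
    constructor
    · have : (s ^ 2 + t ^ 2) • F z = s • (s • F z + t • G z) - t • (-t • F z + s • G z) := by
        module
      rw [hst, h, smul_zero, smul_zero, sub_zero] at this
      exact (smul_eq_zero.1 this).resolve_left hsq
    · have : (s ^ 2 + t ^ 2) • G z = t • (s • F z + t • G z) + s • (-t • F z + s • G z) := by
        module
      rw [hst, h, smul_zero, smul_zero, add_zero] at this
      exact (smul_eq_zero.1 this).resolve_left hsq

/-- If the image of a symmetric form is not spanned by two vectors, every hyperbolic plane has an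
anisotropic vector in its orthogonal complement. -/
lemma exists_orthogonal_anisotropic {F : LinearMap.BilinForm ℝ V}
    (hF : ∀ x y, F x y = F y x)
    (hrank : ∀ p q : V, ∃ v, ∀ a b : ℝ, F v ≠ a • F p + b • F q)
    {x y : V} (hx : F x x = 0) (hy : F y y = 0) (hxy : F x y ≠ 0) :
    ∃ w, F x w = 0 ∧ F y w = 0 ∧ F w w ≠ 0 := by
  by_contra! hcon
  have proj : ∀ v, F x (v - (F y v / F x y) • x - (F x v / F x y) • y) = 0 ∧
      F y (v - (F y v / F x y) • x - (F x v / F x y) • y) = 0 := by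
    intro v
    simp only [map_sub, map_smul, smul_eq_mul, hx, hy, hF y x]
    constructor <;> · field_simp; ring
  have null : ∀ w w', F x w = 0 → F y w = 0 → F x w' = 0 → F y w' = 0 → F w w' = 0 := by
    intro w w' h₁ h₂ h₃ h₄
    have h := hcon (w + w') (by simp [h₁, h₃]) (by simp [h₂, h₄])
    simp only [map_add, LinearMap.add_apply, hcon w h₁ h₂, hcon w' h₃ h₄, hF w' w] at h
    linarith
  obtain ⟨v, hv⟩ := hrank x y
  apply hv (F y v / F x y) (F x v / F x y)
  ext v'
  obtain ⟨p₁, p₂⟩ := proj v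
  obtain ⟨q₁, q₂⟩ := proj v'
  have h := null _ _ p₁ p₂ q₁ q₂
  simp only [map_sub, map_smul, LinearMap.sub_apply, LinearMap.smul_apply, smul_eq_mul,
    hx, hy, hF y x, hF v x, hF v y] at h
  simp only [LinearMap.add_apply, LinearMap.smul_apply, smul_eq_mul]
  field_simp at h ⊢
  apply mul_left_cancel₀ hxy
  linear_combination h

/-- A pencil without nonzero positive semidefinite members that contains a form of rank at least
three has a common zero outside the common kernel. -/
lemma exists_common_zero {F G : LinearMap.BilinForm ℝ V}
    (hF : ∀ x y, F x y = F y x) (hG : ∀ x y, G x y = G y x)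
    (hnd : ∀ a b : ℝ, (∀ x, 0 ≤ a * F x x + b * G x x) → a = 0 ∧ b = 0)
    (hrank : ∀ p q : V, ∃ v, ∀ a b : ℝ, F v ≠ a • F p + b • F q) :
    ∃ z, F z z = 0 ∧ G z z = 0 ∧ ¬(F z = 0 ∧ G z = 0) := by
  have hpos : ∃ u, 0 < F u u := by
    by_contra! h
    have := (hnd (-1) 0 fun x => by linarith [h x]).1
    norm_num at this
  have hneg : ∃ v, F v v < 0 := by
    by_contra! h
    have := (hnd 1 0 fun x => by linarith [h x]).1
    norm_num at this
  obtain ⟨x, hx, hGx⟩ : ∃ x, F x x = 0 ∧ G x x < 0 := by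
    by_contra! h
    obtain ⟨c, hc⟩ := exists_add_mul_nonneg hF hG hpos hneg h
    have := (hnd c 1 fun x => by linarith [hc x]).2
    norm_num at this
  obtain ⟨y, hy, hGy⟩ : ∃ y, F y y = 0 ∧ 0 < G y y := by
    by_contra! h
    obtain ⟨c, hc⟩ := exists_add_mul_nonneg (G := -G) hF (by simpa using hG) hpos hneg
      (by simpa using h)
    simp only [LinearMap.neg_apply] at hc
    have := (hnd c (-1) fun x => by linarith [hc x]).2
    norm_num at this
  by_cases hxy : F x y = 0
  · obtain ⟨t, -, -, -, e, -, -⟩ := exists_neg_pos_roots (G y x) hGy hGx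
    refine ⟨y + t • x, ?_, ?_, ?_⟩
    · simp [hx, hy, hxy, hF y x]
    · simp only [map_add, map_smul, LinearMap.add_apply, LinearMap.smul_apply, smul_eq_mul]
      rw [hG x y]; linarith
    · rintro ⟨-, h⟩
      have h₁ := LinearMap.congr_fun h x
      have h₂ := LinearMap.congr_fun h y
      simp only [map_add, map_smul, LinearMap.add_apply, LinearMap.smul_apply, smul_eq_mul,
        LinearMap.zero_apply] at h₁ h₂
      rw [hG x y] at h₂
      have : G y y = t ^ 2 * G x x := by linear_combination h₂ - t * h₁
      nlinarith [sq_nonneg t]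
  · obtain ⟨w, hxw, hyw, hw⟩ := exists_orthogonal_anisotropic hF hrank hx hy hxy
    obtain ⟨y', hy', hGy', hxy', hyw', k, hk⟩ : ∃ y', F y' y' = 0 ∧ 0 < G y' y' ∧ F x y' ≠ 0 ∧
        F y' w = 0 ∧ ∃ k : ℝ, 2 * F x y' + k ^ 2 * F w w = 0 := by
      rcases le_total 0 (-(2 * F x y) / F w w) with h | h
      · refine ⟨y, hy, hGy, hxy, hyw, √(-(2 * F x y) / F w w), ?_⟩
        rw [Real.sq_sqrt h]
        field_simp
        ring
      · refine ⟨-y, by simpa using hy, by simpa using hGy, by simpa using hxy, by simpa using hyw,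
          √((2 * F x y) / F w w), ?_⟩
        rw [neg_div, neg_nonpos] at h
        rw [Real.sq_sqrt h, map_neg]
        field_simp
        ring
    let p : ℝ → V := fun t => (1 - t) ^ 2 • x + t ^ 2 • y' + (t * (1 - t) * k) • w
    have hcont : Continuous fun t => G (p t) (p t) := by
      simp only [p, map_add, map_smul, LinearMap.add_apply, LinearMap.smul_apply, smul_eq_mul]
      fun_prop
    obtain ⟨t, -, ht⟩ : (0 : ℝ) ∈ (fun t => G (p t) (p t)) '' Set.Icc 0 1 := by
      apply intermediate_value_Icc zero_le_one hcont.continuousOn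
      simp [p, hGx.le, hGy'.le]
    refine ⟨p t, ?_, ht, ?_⟩
    · simp only [p, map_add, map_smul, LinearMap.add_apply, LinearMap.smul_apply, smul_eq_mul,
        hx, hy', hxw, hyw', hF w x, hF w y', hF y' x]
      linear_combination t ^ 2 * (1 - t) ^ 2 * hk
    · rintro ⟨h, -⟩
      have h₁ := LinearMap.congr_fun h x
      simp only [p, map_add, map_smul, LinearMap.add_apply, LinearMap.smul_apply, smul_eq_mul,
        LinearMap.zero_apply, hx, hF w x, hxw, hF y' x, mul_zero, zero_add, add_zero] at h₁
      have h0 : t = 0 := by simpa using (mul_eq_zero.1 h₁).resolve_right hxy'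
      simp only [h0, p] at ht
      simp at ht
      exact hGx.ne ht

end BilinForm

lemma Matrix.toBilin'_comm_of_isSymm {n : ℕ} {A : Matrix (Fin n) (Fin n) ℝ} (hA : A.IsSymm)
    (x y : Fin n → ℝ) : Matrix.toBilin' A x y = Matrix.toBilin' A y x := by
  rw [Matrix.toBilin'_apply', Matrix.toBilin'_apply', Matrix.dotProduct_mulVec,
    ← Matrix.mulVec_transpose, hA.eq, dotProduct_comm]

/-- The image of a matrix of rank at least three is not spanned by two vectors. -/
lemma Matrix.exists_mulVec_ne_of_three_le_rank {n : ℕ} {A : Matrix (Fin n) (Fin n) ℝ}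
    (hA : 3 ≤ A.rank) (p q : Fin n → ℝ) :
    ∃ v, ∀ a b : ℝ, A *ᵥ v ≠ a • A *ᵥ p + b • A *ᵥ q := by
  by_contra! h
  have hle : LinearMap.range A.mulVecLin ≤ Submodule.span ℝ {A *ᵥ p, A *ᵥ q} := by
    rintro _ ⟨v, rfl⟩
    obtain ⟨a, b, hab⟩ := h v
    exact Submodule.mem_span_pair.2 ⟨a, b, hab.symm⟩
  have h₁ := Submodule.finrank_mono hle
  have h₂ : Module.finrank ℝ (Submodule.span ℝ {A *ᵥ p, A *ᵥ q}) ≤ 2 := by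
    have := finrank_span_finset_le_card (R := ℝ) ({A *ᵥ p, A *ᵥ q} : Finset (Fin n → ℝ))
    rw [Finset.coe_pair] at this
    exact this.trans Finset.card_le_two
  rw [Matrix.rank] at hA
  omega

/-- **Theorem 2.9.** Let `A, B` be real symmetric `n × n` matrices forming a
non-dissipative pair with `maxrank{A,B} ≥ 3`. If `A` and `B` are linearly independent, then
there is a point `z` with `Q_A(z) = Q_B(z) = 0` at which `Az` and `Bz` are linearly
independent (the quadrics intersect transversally at `z`). -/
theorem exists_transversal_point {n : ℕ}
    (A B : Matrix (Fin n) (Fin n) ℝ) (hAs : A.IsSymm) (hBs : B.IsSymm)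
    (hnd : ∀ F ∈ Submodule.span ℝ ({A, B} : Set (Matrix (Fin n) (Fin n) ℝ)),
      F.PosSemidef → F = 0)
    (hrank : ∃ F ∈ Submodule.span ℝ ({A, B} : Set (Matrix (Fin n) (Fin n) ℝ)), 3 ≤ F.rank)
    (hind : LinearIndependent ℝ ![A, B]) :
    ∃ z : Fin n → ℝ, z ⬝ᵥ A.mulVec z = 0 ∧ z ⬝ᵥ B.mulVec z = 0 ∧
      LinearIndependent ℝ ![A.mulVec z, B.mulVec z] := by
  rw [LinearIndependent.pair_iff] at hind
  obtain ⟨_, hmem, hrank⟩ := hrank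
  obtain ⟨s, t, rfl⟩ := Submodule.mem_span_pair.1 hmem
  have hst : ¬(s = 0 ∧ t = 0) := by
    rintro ⟨rfl, rfl⟩
    simp at hrank
  have hsq : s ^ 2 + t ^ 2 ≠ 0 := by
    intro h0
    exact hst ⟨by nlinarith [sq_nonneg s, sq_nonneg t], by nlinarith [sq_nonneg s, sq_nonneg t]⟩
  have hFs : (s • A + t • B).IsSymm := (hAs.smul s).add (hBs.smul t)
  have hGs : (-t • A + s • B).IsSymm := (hAs.smul (-t)).add (hBs.smul s)
  have hnd' : ∀ a b : ℝ, (∀ x, 0 ≤ a * Matrix.toBilin' (s • A + t • B) x x +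
      b * Matrix.toBilin' (-t • A + s • B) x x) → a = 0 ∧ b = 0 := by
    intro a b h
    have h0 := hnd (a • (s • A + t • B) + b • (-t • A + s • B))
      (Submodule.mem_span_pair.2 ⟨a * s - b * t, a * t + b * s, by module⟩)
      (Matrix.PosSemidef.of_dotProduct_mulVec_nonneg
        (by simpa [Matrix.IsHermitian] using ((hFs.smul a).add (hGs.smul b)).eq) fun x => by
        have := h x
        rw [Matrix.toBilin'_apply', Matrix.toBilin'_apply'] at this
        rw [star_trivial, Matrix.add_mulVec, Matrix.smul_mulVec a, Matrix.smul_mulVec b,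
          dotProduct_add, dotProduct_smul, dotProduct_smul]
        exact this)
    obtain ⟨e₁, e₂⟩ := hind (a * s - b * t) (a * t + b * s) (by rw [← h0]; module)
    constructor
    · have : (s ^ 2 + t ^ 2) * a = 0 := by linear_combination s * e₁ + t * e₂
      exact (mul_eq_zero.1 this).resolve_left hsq
    · have : (s ^ 2 + t ^ 2) * b = 0 := by linear_combination s * e₂ - t * e₁
      exact (mul_eq_zero.1 this).resolve_left hsq
  have toDual : ∀ {M : Matrix (Fin n) (Fin n) ℝ}, M.IsSymm → ∀ x,
      Matrix.toBilin' M x = dotProductEquiv ℝ (Fin n) (M *ᵥ x) := by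
    intro M hM x
    refine LinearMap.ext fun y => ?_
    rw [Matrix.toBilin'_comm_of_isSymm hM, Matrix.toBilin'_apply', dotProduct_comm]
    simp
  have hFsymm := Matrix.toBilin'_comm_of_isSymm hFs
  have hGsymm := Matrix.toBilin'_comm_of_isSymm hGs
  obtain ⟨z, h₁, h₂, h₃⟩ := exists_common_zero hFsymm hGsymm hnd' (by
    intro p q
    obtain ⟨v, hv⟩ := Matrix.exists_mulVec_ne_of_three_le_rank hrank p q
    refine ⟨v, fun a b hab => hv a b ?_⟩
    rw [toDual hFs, toDual hFs, toDual hFs, ← map_smul, ← map_smul, ← map_add] at hab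
    exact (dotProductEquiv ℝ (Fin n)).injective hab)
  have h := exists_transversal_of_common_zero hFsymm hGsymm hnd' h₁ h₂ h₃
  simp only [map_add, map_smul] at h
  obtain ⟨z, hA, hB, hli⟩ := exists_transversal_of_rotate h
  refine ⟨z, by rwa [Matrix.toBilin'_apply'] at hA, by rwa [Matrix.toBilin'_apply'] at hB, ?_⟩
  rw [LinearIndependent.pair_iff] at hli ⊢
  intro a b hab
  apply hli a b
  rw [toDual hAs, toDual hBs, ← map_smul, ← map_smul, ← map_add, hab, map_zero]
end

section
/- Let A, B ∈ Sym(n,ℝ), and assume that A is neither positive semidefinite nor negative semidefinite. If Q_B(x) = 0 for every x ∈ ℝⁿ with Q_A(x) = 0, then there exists a constant c ∈ ℝ such that B = cA. -/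
open Matrix

/-- If a quadratic form `R` vanishes on the zeros of `Q`, then the ratio `R / Q` takes the same
value at any vector where `Q` is positive and any vector where `Q` is negative. -/
theorem QuadraticForm.mul_eq_mul_of_pos_of_neg {V : Type*} [AddCommGroup V] [Module ℝ V]
    (Q R : QuadraticForm ℝ V) (h : ∀ x, Q x = 0 → R x = 0) {p m : V}
    (hp : 0 < Q p) (hm : Q m < 0) : R p * Q m = R m * Q p := by
  have expand (S : QuadraticForm ℝ V) (a t : ℝ) :
      S (a • p + t • m) = a ^ 2 * S p + a * t * QuadraticMap.polar S p m + t ^ 2 * S m := by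
    rw [QuadraticMap.map_add S, QuadraticMap.map_smul, QuadraticMap.map_smul,
      QuadraticMap.polar_smul_left, QuadraticMap.polar_smul_right]
    simp only [smul_eq_mul]
    ring
  set b := QuadraticMap.polar Q p m
  have hdisc : 0 < b ^ 2 - 4 * Q p * Q m := by nlinarith [sq_nonneg b, mul_neg_of_pos_of_neg hp hm]
  obtain ⟨s, hs, hs2⟩ : ∃ s : ℝ, 0 < s ∧ s ^ 2 = b ^ 2 - 4 * Q p * Q m :=
    ⟨√_, Real.sqrt_pos.2 hdisc, Real.sq_sqrt hdisc.le⟩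
  have h₁ := h ((2 * Q m) • p + (-b + s) • m) (by
    rw [expand]; linear_combination Q m * hs2)
  have h₂ := h ((2 * Q m) • p + (-b - s) • m) (by
    rw [expand]; linear_combination Q m * hs2)
  rw [expand] at h₁ h₂
  have hb : Q m * QuadraticMap.polar R p m = b * R m :=
    mul_left_cancel₀ hs.ne' (by linear_combination (h₁ - h₂) / 4)
  refine mul_left_cancel₀ hm.ne ?_
  linear_combination (h₁ + h₂) / 8 + b / 2 * hb - R m / 4 * hs2

/-- A quadratic form vanishing on the zeros of an indefinite quadratic form is a multiple of it. -/
theorem QuadraticForm.exists_eq_smul_of_indefinite {V : Type*} [AddCommGroup V] [Module ℝ V]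
    (Q R : QuadraticForm ℝ V) (h : ∀ x, Q x = 0 → R x = 0) {p m : V}
    (hp : 0 < Q p) (hm : Q m < 0) : ∃ c : ℝ, R = c • Q := by
  have hpm := mul_eq_mul_of_pos_of_neg Q R h hp hm
  refine ⟨R p / Q p, QuadraticMap.ext fun x => ?_⟩
  rw [_root_.smul_apply, smul_eq_mul, div_mul_eq_mul_div, eq_div_iff hp.ne']
  rcases lt_trichotomy (Q x) 0 with hx | hx | hx
  · exact (mul_eq_mul_of_pos_of_neg Q R h hp hx).symm
  · simp [hx, h x hx]
  · refine mul_right_cancel₀ hm.ne ?_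
    linear_combination Q p * mul_eq_mul_of_pos_of_neg Q R h hx hm - Q x * hpm

theorem Matrix.toQuadraticForm'_apply_eq_dotProduct {ι : Type*} [Fintype ι] [DecidableEq ι]
    (A : Matrix ι ι ℝ) (x : ι → ℝ) : A.toQuadraticForm' x = x ⬝ᵥ A.mulVec x := by
  simp [Matrix.toQuadraticForm', Matrix.toLinearMap₂'_apply']

/-- A real symmetric matrix that is not positive semidefinite takes a negative value. -/
theorem Matrix.IsSymm.exists_dotProduct_mulVec_neg {ι : Type*} [Fintype ι] {A : Matrix ι ι ℝ}
    (hA : A.IsSymm) (h : ¬ A.PosSemidef) : ∃ x, x ⬝ᵥ A.mulVec x < 0 := by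
  by_contra! hx
  exact h (.of_dotProduct_mulVec_nonneg
    (by rwa [Matrix.IsHermitian, conjTranspose_eq_transpose_of_trivial]) (by simpa using hx))

/-- A real symmetric matrix is determined by its quadratic form. -/
theorem Matrix.IsSymm.eq_of_dotProduct_mulVec {ι : Type*} [Fintype ι] {A B : Matrix ι ι ℝ}
    (hA : A.IsSymm) (hB : B.IsSymm) (h : ∀ x, x ⬝ᵥ A.mulVec x = x ⬝ᵥ B.mulVec x) : A = B := by
  open scoped MatrixOrder in
  refine le_antisymm ?_ ?_ <;> rw [Matrix.le_iff] <;> by_contra hn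
  · obtain ⟨x, hx⟩ := (hB.sub hA).exists_dotProduct_mulVec_neg hn
    simp [sub_mulVec, h] at hx
  · obtain ⟨x, hx⟩ := (hA.sub hB).exists_dotProduct_mulVec_neg hn
    simp [sub_mulVec, h] at hx

/-- **Lemma 3.1 (a).** Let `A, B` be real symmetric `n × n` matrices with `A`
neither positive semidefinite nor negative semidefinite. If `Q_B` vanishes on the zero set
of `Q_A`, then `B = c • A` for some `c ∈ ℝ`. -/
theorem eq_smul_of_vanish_on_quadric {n : ℕ}
    (A B : Matrix (Fin n) (Fin n) ℝ) (hAs : A.IsSymm) (hBs : B.IsSymm)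
    (hA1 : ¬ A.PosSemidef) (hA2 : ¬ (-A).PosSemidef)
    (h : ∀ x : Fin n → ℝ, x ⬝ᵥ A.mulVec x = 0 → x ⬝ᵥ B.mulVec x = 0) :
    ∃ c : ℝ, B = c • A := by
  obtain ⟨m, hm⟩ := hAs.exists_dotProduct_mulVec_neg hA1
  obtain ⟨p, hp⟩ := hAs.neg.exists_dotProduct_mulVec_neg hA2
  rw [neg_mulVec, dotProduct_neg, neg_lt_zero] at hp
  simp only [← toQuadraticForm'_apply_eq_dotProduct] at hm hp h
  obtain ⟨c, hc⟩ := QuadraticForm.exists_eq_smul_of_indefinite _ _ h hp hm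
  refine ⟨c, hBs.eq_of_dotProduct_mulVec (hAs.smul c) fun x => ?_⟩
  rw [smul_mulVec, dotProduct_smul, ← toQuadraticForm'_apply_eq_dotProduct,
    ← toQuadraticForm'_apply_eq_dotProduct, hc, _root_.smul_apply]
end

section
/- Let A be a real n×n matrix and let T be a real n×(n−m) matrix of rank n−m (i.e. the corresponding linear map T : ℝ^{n−m} → ℝⁿ is injective). Then rank(TᵀAT) ≥ rank A − 2m. -/
open Matrix

/-- A linear map drops the dimension of a subspace by at most the dimension of its kernel. -/
theorem Submodule.finrank_le_finrank_map_add_finrank_ker {K V W : Type*} [Field K]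
    [AddCommGroup V] [Module K V] [FiniteDimensional K V] [AddCommGroup W] [Module K W]
    (f : V →ₗ[K] W) (p : Submodule K V) :
    Module.finrank K p ≤ Module.finrank K (p.map f) + Module.finrank K (LinearMap.ker f) := by
  have h := (f.domRestrict p).finrank_range_add_finrank_ker
  rw [LinearMap.range_domRestrict] at h
  have hker : Module.finrank K (LinearMap.ker (f.domRestrict p)) ≤
      Module.finrank K (LinearMap.ker f) := by
    rw [← Submodule.finrank_map_subtype_eq p (LinearMap.ker (f.domRestrict p))]
    refine Submodule.finrank_mono ?_
    rintro _ ⟨x, hx, rfl⟩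
    exact hx
  omega

/-- Sylvester's rank inequality. -/
theorem Matrix.rank_add_rank_le_rank_mul_add_card {K l m n : Type*} [Field K]
    [Fintype m] [Fintype n] (A : Matrix l m K) (B : Matrix m n K) :
    A.rank + B.rank ≤ (A * B).rank + Fintype.card m := by
  have h := Submodule.finrank_le_finrank_map_add_finrank_ker A.mulVecLin
    (LinearMap.range B.mulVecLin)
  have hA := A.mulVecLin.finrank_range_add_finrank_ker
  rw [← LinearMap.range_comp, ← Matrix.mulVecLin_mul] at h
  rw [Module.finrank_fintype_fun_eq_card] at hA
  simp only [Matrix.rank]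
  omega

/-- **Lemma 3.2.** Let `A` be a real `n × n` matrix and `T` a real
`n × (n − m)` matrix which is injective as a linear map. Then
`rank (Tᵀ A T) ≥ rank A − 2m`. -/
theorem rank_conjTranspose_mul_ge {n m : ℕ} (hm : m ≤ n)
    (A : Matrix (Fin n) (Fin n) ℝ)
    (T : Matrix (Fin n) (Fin (n - m)) ℝ)
    (hT : Function.Injective T.mulVec) :
    (A.rank : ℤ) - 2 * m ≤ ((Tᵀ * A * T).rank : ℤ) := by
  have hrank : T.rank = n - m := by
    have h := LinearMap.finrank_range_of_inj (f := T.mulVecLin) hT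
    simpa [Matrix.rank] using h
  have hleft := Matrix.rank_add_rank_le_rank_mul_add_card Tᵀ A
  have hright := Matrix.rank_add_rank_le_rank_mul_add_card (Tᵀ * A) T
  rw [Matrix.rank_transpose, hrank, Fintype.card_fin] at hleft
  rw [hrank, Fintype.card_fin] at hright
  omega
end

section
/- Let A, B ∈ Sym(n,ℝ), let I ⊆ ℝ be a nonempty open interval, let E : I → ℝ^{n×(n−m)} be a differentiable matrix-valued map such that E(t) has rank n−m (is injective as a linear map) for every t ∈ I, and let μ : I → ℝ be differentiable. Assume E(t)ᵀ B E(t) = μ(t) · E(t)ᵀ A E(t) for every t ∈ I. If rank A > 4m, then μ is constant on I. -/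
open Matrix

namespace Matrix

variable {K l m n : Type*} [Field K] [Fintype n]

theorem rank_add_le [Fintype m] (A B : Matrix m n K) : (A + B).rank ≤ A.rank + B.rank := by
  have hle : LinearMap.range (A + B).mulVecLin ≤
      LinearMap.range A.mulVecLin ⊔ LinearMap.range B.mulVecLin := by
    rw [mulVecLin_add]
    exact LinearMap.range_add_le _ _
  exact (Submodule.finrank_mono hle).trans (Submodule.finrank_add_le_finrank_add_finrank _ _)

theorem rank_smul_of_ne_zero {c : K} (hc : c ≠ 0) (A : Matrix m n K) : (c • A).rank = A.rank :=
  rank_smul_of_mem_nonZeroDivisors A (mem_nonZeroDivisors_of_ne_zero hc)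

/-- Sylvester's rank inequality. -/
theorem rank_add_rank_le_rank_mul_add_card_s11 [Fintype m] (A : Matrix l m K) (B : Matrix m n K) :
    A.rank + B.rank ≤ (A * B).rank + Fintype.card m := by
  have hA := LinearMap.finrank_range_add_finrank_ker A.mulVecLin
  have hAB := LinearMap.finrank_range_add_finrank_ker
    (A.mulVecLin.domRestrict (LinearMap.range B.mulVecLin))
  have hrange : LinearMap.range (A.mulVecLin.domRestrict (LinearMap.range B.mulVecLin)) =
      LinearMap.range (A * B).mulVecLin := by
    rw [LinearMap.range_domRestrict, mulVecLin_mul, LinearMap.range_comp]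
  have hker : Module.finrank K
      (LinearMap.ker (A.mulVecLin.domRestrict (LinearMap.range B.mulVecLin))) ≤
      Module.finrank K (LinearMap.ker A.mulVecLin) := by
    refine LinearMap.finrank_le_finrank_of_injective
      (f := (LinearMap.range B.mulVecLin).subtype.restrict fun x hx => hx) ?_
    intro x y hxy
    have hval := congrArg Subtype.val hxy
    exact Subtype.ext (Subtype.ext hval)
  rw [hrange] at hAB
  rw [Module.finrank_fintype_fun_eq_card] at hA
  simp only [rank]
  omega

/-- A bilinear form with a totally isotropic subspace of codimension `k` has rank at most `2k`. -/
theorem rank_add_two_mul_card_le_of_transpose_mul_mul_eq_zero [Fintype l]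
    {C : Matrix n n K} {E : Matrix n l K} (hE : Function.Injective E.mulVec)
    (h : Eᵀ * C * E = 0) : C.rank + 2 * Fintype.card l ≤ 2 * Fintype.card n := by
  have hrank : E.rank = Fintype.card l := by
    rw [rank, LinearMap.finrank_range_of_inj (f := E.mulVecLin) hE,
      Module.finrank_fintype_fun_eq_card]
  have h₁ := rank_add_rank_le_card_of_mul_eq_zero h
  have h₂ := rank_add_rank_le_rank_mul_add_card_s11 Eᵀ C
  rw [rank_transpose] at h₂
  omega

end Matrix

/-- **Lemma 3.3.** Let `A, B` be real symmetric `n × n` matrices, let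
`I = (a, b)` be a nonempty open interval, `E : I → ℝ^{n×(n−m)}` differentiable (entrywise)
with `E(t)` injective for every `t ∈ I`, and `μ : I → ℝ` differentiable, such that
`E(t)ᵀ B E(t) = μ(t) • E(t)ᵀ A E(t)` on `I`. If `rank A > 4m`, then `μ` is constant on `I`. -/
theorem mu_constant_of_rank_gt {n m : ℕ}
    (A B : Matrix (Fin n) (Fin n) ℝ) (hAs : A.IsSymm) (hBs : B.IsSymm)
    (a b : ℝ) (hab : a < b)
    (E : ℝ → Matrix (Fin n) (Fin (n - m)) ℝ)
    (hE : ∀ i j, DifferentiableOn ℝ (fun t => E t i j) (Set.Ioo a b))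
    (hinj : ∀ t ∈ Set.Ioo a b, Function.Injective (E t).mulVec)
    (μ : ℝ → ℝ) (hμ : DifferentiableOn ℝ μ (Set.Ioo a b))
    (heq : ∀ t ∈ Set.Ioo a b, (E t)ᵀ * B * E t = μ t • ((E t)ᵀ * A * E t))
    (hrank : 4 * m < A.rank) :
    ∀ s ∈ Set.Ioo a b, ∀ t ∈ Set.Ioo a b, μ s = μ t := by
  intro s hs t ht
  by_contra hst
  have hn : A.rank ≤ n := A.rank_le_width
  have hC : ∀ r ∈ Set.Ioo a b, (B - μ r • A).rank ≤ 2 * m := by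
    intro r hr
    have h := rank_add_two_mul_card_le_of_transpose_mul_mul_eq_zero (C := B - μ r • A)
      (hinj r hr) (by simp [Matrix.mul_sub, Matrix.sub_mul, heq r hr])
    simp only [Fintype.card_fin] at h
    omega
  have hdiff : (μ t - μ s) • A = (B - μ s • A) + (-1 : ℝ) • (B - μ t • A) := by
    module
  have hle := rank_add_le (B - μ s • A) ((-1 : ℝ) • (B - μ t • A))
  rw [← hdiff, rank_smul_of_ne_zero (sub_ne_zero.mpr (Ne.symm hst)),
    rank_smul_of_ne_zero (by norm_num)] at hle
  have hCs := hC s hs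
  have hCt := hC t ht
  omega
end
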